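/- Let d ≥ 2, let q = p^e be a prime power with (d,q) ≠ (2,2) and (d,q) ≠ (2,3), and let G = SL(d,q) (which is quasisimple). Let F be an algebraically closed field of characteristic p and M a finite-dimensional irreducible FG-module. Then for every prime ℓ with ℓ ≤ d, ℓ·dim H^1(G,M) ≤ dim M; in particular dim H^1(G,M) ≤ dim M/d' where d' is the largest prime with d' ≤ d. -/

import Mathlib

open Module

section Cohomology

variable {F G M : Type} [Field F] [Group G] [AddCommGroup M] [Module F M]

/-- The space of `1`-cocycles of a representation. -/
def cocycleSpace (ρ : Representation F G M) : Submodule F (G → M) where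
  carrier := {c | ∀ g h, c (g * h) = ρ g (c h) + c g}
  add_mem' := by
    intro a b ha hb g h
    simp only [Set.mem_ofPred_eq] at ha hb
    simp only [Pi.add_apply, ha, hb, map_add]
    abel
  zero_mem' := by intro g h; simp
  smul_mem' := by
    intro r a ha g h
    simp only [Set.mem_ofPred_eq] at ha
    simp [ha]

theorem cocycleSpace_one {ρ : Representation F G M} {c : G → M} (hc : c ∈ cocycleSpace ρ) :
    c 1 = 0 := by
  have := hc 1 1
  simpa using this

theorem cocycleSpace_inv {ρ : Representation F G M} {c : G → M} (hc : c ∈ cocycleSpace ρ) (g : G) :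
    c g⁻¹ = - ρ g⁻¹ (c g) := by
  have := hc g⁻¹ g
  rw [inv_mul_cancel, cocycleSpace_one hc] at this
  exact eq_neg_of_add_eq_zero_right this.symm

/-- A cocycle vanishing on a generating set vanishes. -/
theorem cocycleSpace_eq_zero_of_closure {ρ : Representation F G M} {c : G → M}
    (hc : c ∈ cocycleSpace ρ) {S : Set G} (hS : Subgroup.closure S = ⊤)
    (h : ∀ s ∈ S, c s = 0) : c = 0 := by
  funext g
  have hg : g ∈ Subgroup.closure S := hS ▸ Subgroup.mem_top g
  induction hg using Subgroup.closure_induction with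
  | mem x hx => exact h x hx
  | one => exact cocycleSpace_one hc
  | mul x y _ _ hx hy => simp only [Pi.zero_apply] at hx hy; simp [hc x y, hx, hy]
  | inv x _ hx => simp only [Pi.zero_apply] at hx; simp [cocycleSpace_inv hc, hx]

/-- The class map from the cocycles onto the first cohomology. -/
theorem exists_cocycleSpace_surjection (ρ : Representation F G M) :
    ∃ f : cocycleSpace ρ →ₗ[F] groupCohomology (Rep.of ρ) 1, Function.Surjective f ∧
      ∀ c, f c = 0 ↔ ∃ x : M, ∀ g, c.1 g = ρ g x - x := by
  have hmem : ∀ c : G → M, c ∈ cocycleSpace ρ ↔ c ∈ groupCohomology.cocycles₁ (Rep.of ρ) := by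
    intro c
    rw [groupCohomology.mem_cocycles₁_iff]
    rfl
  let e : cocycleSpace ρ →ₗ[F] groupCohomology.cocycles₁ (Rep.of ρ) :=
    { toFun := fun c => ⟨c.1, (hmem _).1 c.2⟩
      map_add' := fun _ _ => rfl
      map_smul' := fun _ _ => rfl }
  refine ⟨(groupCohomology.H1π (Rep.of ρ)).hom.comp e, ?_, ?_⟩
  · intro x
    induction x using groupCohomology.H1_induction_on with
    | h x => exact ⟨⟨x.1, (hmem _).2 x.2⟩, rfl⟩
  · intro c
    have := groupCohomology.H1π_eq_zero_iff (e c)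
    refine this.trans ?_
    constructor
    · rintro ⟨x, hx⟩
      exact ⟨x, fun g => (congrFun hx g).symm⟩
    · rintro ⟨x, hx⟩
      exact ⟨x, funext fun g => (hx g).symm⟩

theorem finrank_groupCohomology_add [Finite G] [FiniteDimensional F M] (ρ : Representation F G M)
    (hinv : ∀ v, (∀ g, ρ g v = v) → v = 0) :
    finrank F (groupCohomology (Rep.of ρ) 1) + finrank F M = finrank F (cocycleSpace ρ) := by
  obtain ⟨f, hf, hk⟩ := exists_cocycleSpace_surjection ρ
  let d : M →ₗ[F] cocycleSpace ρ :=
    { toFun := fun x => ⟨fun g => ρ g x - x, by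
        intro g h
        simp⟩
      map_add' := by
        intro x y; ext g; simp; abel
      map_smul' := by
        intro x y; ext g; simp [smul_sub] }
  have hd : Function.Injective d := by
    rw [injective_iff_map_eq_zero]
    intro x hx
    apply hinv
    intro g
    have := congrFun (congrArg Subtype.val hx) g
    exact sub_eq_zero.1 this
  have hker : LinearMap.ker f = LinearMap.range d := by
    ext c
    rw [LinearMap.mem_ker, hk]
    constructor
    · rintro ⟨x, hx⟩
      exact ⟨x, Subtype.ext (funext fun g => (hx g).symm)⟩
    · rintro ⟨x, rfl⟩
      exact ⟨x, fun g => rfl⟩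
  rw [← LinearMap.finrank_range_add_finrank_ker f, LinearMap.range_eq_top.2 hf, finrank_top, hker,
    LinearMap.finrank_range_of_inj hd]

/-- The average of a cocycle over a finite group of order prime to the characteristic. -/
theorem cocycleSpace_eq_coboundary {ρ : Representation F G M} {c : G → M}
    (hc : c ∈ cocycleSpace ρ) {A : Type} [Group A] [Fintype A] (hA : (Fintype.card A : F) ≠ 0)
    (θ : A →* G) (hsum : ∑ a, c (θ a) = 0) (b : A) : c (θ b) = 0 := by
  have h1 : ∑ a, c (θ (b * a)) = 0 := by
    rw [← hsum]
    exact Fintype.sum_equiv (Equiv.mulLeft b) _ _ (fun a => rfl)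
  simp only [map_mul, hc (θ b), Finset.sum_add_distrib, ← map_sum, hsum, map_zero, zero_add,
    Finset.sum_const, Finset.card_univ, ← Nat.cast_smul_eq_nsmul F] at h1
  exact (smul_eq_zero.1 h1).resolve_left hA

theorem sum_apply_sum {ρ : Representation F G M} {A : Type} [Group A] [Fintype A]
    (θ : A →* G) (b : A) (v : M) : ρ (θ b) (∑ a, ρ (θ a) v) = ∑ a, ρ (θ a) v := by
  rw [map_sum]
  refine Fintype.sum_equiv (Equiv.mulLeft b) _ _ (fun a => ?_)
  simp [map_mul]

/-- Bounding the first cohomology by cocycles normalized on `A` and on an element normalizing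
`A`. -/
theorem finrank_groupCohomology_le [Finite G] [FiniteDimensional F M] (ρ : Representation F G M)
    (hinv : ∀ v, (∀ g, ρ g v = v) → v = 0)
    {A : Type} [Group A] [Fintype A] (hA : (Fintype.card A : F) ≠ 0) (θ : A →* G) (w : G)
    (hw : ∀ a', ∃ a, w * θ a = θ a' * w)
    {V : Type} [AddCommGroup V] [Module F V] [FiniteDimensional F V]
    (T : (G → M) →ₗ[F] V) (P : Submodule F V)
    (hT : ∀ c ∈ cocycleSpace ρ, (∀ a, c (θ a) = 0) → c w = 0 → T c = 0 → c = 0)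
    (hP : ∀ c ∈ cocycleSpace ρ, (∀ a, c (θ a) = 0) → c w = 0 → T c ∈ P) :
    finrank F (groupCohomology (Rep.of ρ) 1) ≤ finrank F P := by
  have hadd := finrank_groupCohomology_add ρ hinv
  let n : F := Fintype.card A
  let Ψ : (G → M) →ₗ[F] M := 
    { toFun := fun c => n • ∑ a, c (θ a) + ∑ a, ρ (θ a) (c w) - ∑ a, ρ (θ a) (∑ b, c (θ b))
      map_add' := by
        intro x y
        simp only [Pi.add_apply, Finset.sum_add_distrib, map_add, smul_add]
        abel
      map_smul' := by
        intro r x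
        simp only [Pi.smul_apply, ← Finset.smul_sum, map_smul, RingHom.id_apply, smul_sub, smul_add]
        rw [smul_comm] }
  let Ψ' := Ψ.comp (cocycleSpace ρ).subtype
  have hΨ : ∀ c : cocycleSpace ρ, Ψ' c = 0 → (∀ a, c.1 (θ a) = 0) ∧ c.1 w = 0 := by
    rintro ⟨c, hc⟩ h0
    have h0' : n • ∑ a, c (θ a) + ∑ a, ρ (θ a) (c w) - ∑ a, ρ (θ a) (∑ b, c (θ b)) = 0 := h0
    have hinvE : ∀ b v, ρ (θ b) (∑ a, ρ (θ a) v) = ∑ a, ρ (θ a) v := fun b v => sum_apply_sum θ b v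
    set s := ∑ a, c (θ a) with hs
    -- the sum is fixed by `A`, hence it equals its average
    have hfix : ∀ b, ρ (θ b) s = s := by
      intro b
      have h1 : n • s = ∑ a, ρ (θ a) s - ∑ a, ρ (θ a) (c w) := by
        rw [eq_sub_iff_add_eq, ← sub_eq_zero]; exact h0'
      have h2 : n • ρ (θ b) s = n • s := by
        rw [← map_smul, h1, map_sub, hinvE, hinvE]
      exact smul_right_injective _ hA h2
    have hs0 : s = 0 := by
      have h3 : ∀ b, c (θ b) = 0 := by
        intro b
        have h1 : ∑ a, c (θ (b * a)) = s := by
          rw [hs]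
          exact Fintype.sum_equiv (Equiv.mulLeft b) _ _ (fun a => rfl)
        simp only [map_mul, hc (θ b), Finset.sum_add_distrib, ← map_sum, Finset.sum_const,
          Finset.card_univ, ← Nat.cast_smul_eq_nsmul F] at h1
        rw [← hs, hfix, add_eq_left] at h1
        exact (smul_eq_zero.1 h1).resolve_left hA
      simp [hs, h3]
    have hA0 : ∀ b, c (θ b) = 0 := cocycleSpace_eq_coboundary hc hA θ hs0
    refine ⟨hA0, ?_⟩
    rw [hs0] at h0'
    have hwfix : ∀ a', ρ (θ a') (c w) = c w := by
      intro a'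
      obtain ⟨a, ha⟩ := hw a'
      have h1 := hc w (θ a)
      rw [ha, hc (θ a') w, hA0, hA0, add_zero, map_zero, zero_add] at h1
      exact h1
    simp only [hwfix, smul_zero, zero_add, map_zero, Finset.sum_const_zero, sub_zero,
      Finset.sum_const, Finset.card_univ, ← Nat.cast_smul_eq_nsmul F] at h0'
    exact (smul_eq_zero.1 h0').resolve_left hA
  have hker : finrank F (LinearMap.ker Ψ') ≤ finrank F P := by
    let T' : LinearMap.ker Ψ' →ₗ[F] P :=
      ((T.comp (cocycleSpace ρ).subtype).comp (LinearMap.ker Ψ').subtype).codRestrict P (by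
        rintro ⟨c, hc⟩
        exact hP c.1 c.2 (hΨ c hc).1 (hΨ c hc).2)
    apply LinearMap.finrank_le_finrank_of_injective (f := T')
    rw [injective_iff_map_eq_zero]
    rintro ⟨c, hc⟩ h
    have := hT c.1 c.2 (hΨ c hc).1 (hΨ c hc).2 (congrArg Subtype.val h)
    exact Subtype.ext (Subtype.ext this)
  have := LinearMap.finrank_range_add_finrank_ker Ψ'
  have := Submodule.finrank_le (LinearMap.range Ψ')
  omega

end Cohomology

section FixedPoints

variable {F G M : Type} [Field F] [Group G] [AddCommGroup M] [Module F M]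

/-- Vectors fixed by `w` with vanishing sum over the powers of `t`. -/
def normalizedFixed (ρ : Representation F G M) (w t : G) (r : ℕ) : Submodule F M where
  carrier := {v | ρ w v = v ∧ ∑ i ∈ Finset.range r, ρ (t ^ i) v = 0}
  add_mem' := by
    rintro a b ⟨ha, ha'⟩ ⟨hb, hb'⟩
    refine ⟨by rw [map_add, ha, hb], ?_⟩
    simp only [map_add, Finset.sum_add_distrib, ha', hb', add_zero]
  zero_mem' := by simp
  smul_mem' := by
    rintro k a ⟨ha, ha'⟩
    refine ⟨by rw [map_smul, ha], ?_⟩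
    simp only [map_smul, ← Finset.smul_sum, ha', smul_zero]

theorem eq_zero_of_sum_of_fixed {ρ : Representation F G M} {t : G} {r : ℕ} (hr : (r : F) ≠ 0)
    {v : M} (hsum : ∑ i ∈ Finset.range r, ρ (t ^ i) v = 0) (hv : ρ t v = v) : v = 0 := by
  have h : ∀ i, ρ (t ^ i) v = v := by
    intro i
    induction i with
    | zero => simp
    | succ i ih => rw [pow_succ, map_mul, Module.End.mul_apply, hv, ih]
  simp only [h, Finset.sum_const, Finset.card_range, ← Nat.cast_smul_eq_nsmul F] at hsum
  exact (smul_eq_zero.1 hsum).resolve_left hr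

theorem fixed_of_pow_fixed {ρ : Representation F G M} {t : G} {j k : ℕ} (hjk : (t ^ j) ^ k = t)
    {v : M} (hv : ρ (t ^ j) v = v) : ρ t v = v := by
  have h : ∀ i, ρ ((t ^ j) ^ i) v = v := by
    intro i
    induction i with
    | zero => simp
    | succ i ih => rw [pow_succ, map_mul, Module.End.mul_apply, hv, ih]
  have := h k
  rwa [hjk] at this

theorem sum_pow_apply {ρ : Representation F G M} {t : G} {r : ℕ} {v : M} (g : G)
    (hg : Commute g t)
    (hsum : ∑ i ∈ Finset.range r, ρ (t ^ i) v = 0) :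
    ∑ i ∈ Finset.range r, ρ (t ^ i) (ρ g v) = 0 := by
  have : ∀ i, ρ (t ^ i) (ρ g v) = ρ g (ρ (t ^ i) v) := by
    intro i
    rw [← Module.End.mul_apply, ← Module.End.mul_apply, ← map_mul, ← map_mul,
      (hg.pow_right i).eq]
  simp only [this, ← map_sum, hsum, map_zero]

theorem finrank_groupCohomology_le_normalizedFixed [Finite G] [FiniteDimensional F M]
    (ρ : Representation F G M) (hinv : ∀ v, (∀ g, ρ g v = v) → v = 0)
    {A : Type} [Group A] [Fintype A] (hA : (Fintype.card A : F) ≠ 0) (θ : A →* G) (w t : G)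
    (hw : ∀ a', ∃ a, w * θ a = θ a' * w) {r k : ℕ} (hr : (r : F) ≠ 0) (ht : t ^ r = 1)
    (hk : w * t = t ^ k * w) (hkr : k.Coprime r)
    (hgen : Subgroup.closure (Set.range θ ∪ {w, t}) = ⊤) :
    finrank F (groupCohomology (Rep.of ρ) 1) ≤ finrank F (normalizedFixed ρ w t r) := by
  let T : (G → M) →ₗ[F] M :=
    { toFun := fun c => ∑ i ∈ Finset.range r, c (t ^ i)
      map_add' := fun x y => by simp [Finset.sum_add_distrib]
      map_smul' := fun a x => by simp [Finset.smul_sum] }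
  -- the shift formula
  have hshift : ∀ c ∈ cocycleSpace ρ, T c = ρ t (T c) + (r : F) • c t := by
    intro c hc
    have h1 : ∑ i ∈ Finset.range r, c (t ^ (i + 1)) = T c := by
      have h2 := Finset.sum_range_succ (fun i => c (t ^ i)) r
      have h3 := Finset.sum_range_succ' (fun i => c (t ^ i)) r
      rw [h2] at h3
      simp only [ht, pow_zero, add_left_inj] at h3
      exact h3.symm
    refine h1.symm.trans ?_
    simp only [pow_succ', hc t, Finset.sum_add_distrib, Finset.sum_const, Finset.card_range,
      ← Nat.cast_smul_eq_nsmul F, ← map_sum]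
    rfl
  refine finrank_groupCohomology_le ρ hinv hA θ w hw T _ ?_ ?_
  · intro c hc hcA hcw hT
    apply cocycleSpace_eq_zero_of_closure hc hgen
    rintro s (⟨a, rfl⟩ | hs)
    · exact hcA a
    · rcases hs with rfl | hs
      · exact hcw
      · rw [Set.mem_singleton_iff.1 hs]
        have := hshift c hc
        rw [hT, map_zero, zero_add] at this
        exact (smul_eq_zero.1 this.symm).resolve_left hr
  · intro c hc hcA hcw
    have hwt : ∀ i, w * t ^ i = t ^ (k * i) * w := by
      intro i
      induction i with
      | zero => simp
      | succ i ih => rw [pow_succ, ← mul_assoc, ih, mul_assoc, hk, ← mul_assoc, ← pow_add,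
          Nat.mul_succ]
    have hcwt : ∀ i, ρ w (c (t ^ i)) = c (t ^ (k * i)) := by
      intro i
      have h1 := hc w (t ^ i)
      rw [hwt, hc _ w, hcw, map_zero, zero_add, add_zero] at h1
      exact h1.symm
    refine ⟨?_, ?_⟩
    · change ρ w (∑ i ∈ Finset.range r, c (t ^ i)) = ∑ i ∈ Finset.range r, c (t ^ i)
      rw [map_sum]
      have hr0 : 0 < r := Nat.pos_of_ne_zero (by rintro rfl; simp at hr)
      refine Finset.sum_nbij (fun i => k * i % r) ?_ ?_ ?_ ?_
      · intro i _
        simpa using Nat.mod_lt _ hr0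
      · intro i hi j hj hij
        simp only [Finset.coe_range, Set.mem_Iio] at hi hj
        have : k * i ≡ k * j [MOD r] := hij
        have := Nat.ModEq.cancel_left_of_coprime hkr.symm this
        rwa [Nat.ModEq, Nat.mod_eq_of_lt hi, Nat.mod_eq_of_lt hj] at this
      · apply Finset.surjOn_of_injOn_of_card_le
        · intro i _
          simpa using Nat.mod_lt _ hr0
        · intro i hi j hj hij
          simp only [Finset.coe_range, Set.mem_Iio] at hi hj
          have : k * i ≡ k * j [MOD r] := hij
          have := Nat.ModEq.cancel_left_of_coprime hkr.symm this
          rwa [Nat.ModEq, Nat.mod_eq_of_lt hi, Nat.mod_eq_of_lt hj] at this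
        · rfl
      · intro i _
        rw [hcwt, ← pow_mod_orderOf, ← pow_mod_orderOf t (k * i % r), 
          Nat.mod_mod_of_dvd _ (orderOf_dvd_of_pow_eq_one ht)]
    · have h1 : ∀ n, ∑ i ∈ Finset.range n, ρ (t ^ i) (c t) = c (t ^ n) := by
        intro n
        induction n with
        | zero => simp [cocycleSpace_one hc]
        | succ n ih => rw [Finset.sum_range_succ, ih, pow_succ, hc (t ^ n) t, add_comm]
      change ∑ i ∈ Finset.range r, ρ (t ^ i) (T c) = 0
      have hT : T c = ∑ j ∈ Finset.range r, c (t ^ j) := rfl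
      rw [hT]
      simp only [map_sum, fun i j => (eq_sub_of_add_eq (hc (t ^ i) (t ^ j)).symm)]
      simp only [Finset.sum_sub_distrib, Finset.sum_const, Finset.card_range]
      rw [← Finset.smul_sum, ← hT]
      have h4 : ∀ i, ∑ j ∈ Finset.range r, c (t ^ i * t ^ j) = T c := by
        intro i
        induction i with
        | zero => simp [hT]
        | succ i ih =>
          have h2 := Finset.sum_range_succ (fun j => c (t ^ i * t ^ j)) r
          have h3 := Finset.sum_range_succ' (fun j => c (t ^ i * t ^ j)) r
          rw [h2] at h3
          simp only [ht, pow_zero, add_left_inj] at h3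
          rw [← ih, h3]
          simp only [pow_succ', mul_assoc, ← pow_add]
          refine Finset.sum_congr rfl fun j _ => congrArg c ?_
          group
      simp [h4]

/-- Two translates of the normalized fixed space of an inverting element are independent. -/
theorem two_mul_finrank_normalizedFixed [FiniteDimensional F M] {ρ : Representation F G M}
    {w t : G} {r : ℕ} (hr : (r : F) ≠ 0) (hodd : Odd r) (ht : t ^ r = 1)
    (hk : w * t = t⁻¹ * w) :
    2 * finrank F (normalizedFixed ρ w t r) ≤ finrank F M := by
  set N := normalizedFixed ρ w t r
  let f : N × N →ₗ[F] M := N.subtype.coprod ((ρ t).comp N.subtype)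
  have hf : Function.Injective f := by
    rw [injective_iff_map_eq_zero]
    rintro ⟨⟨x, hx1, hx2⟩, ⟨y, hy1, hy2⟩⟩ h
    have h1 : x + ρ t y = 0 := h
    have h2 : x + ρ t⁻¹ y = 0 := by
      have := congrArg (ρ w) h1
      rwa [map_add, hx1, map_zero, ← Module.End.mul_apply, ← map_mul, hk, map_mul,
        Module.End.mul_apply, hy1] at this
    have h3 : ρ t y = ρ t⁻¹ y := by
      rw [← h2] at h1; exact add_left_cancel h1
    have h4 : ρ (t ^ 2) y = y := by
      have := congrArg (ρ t) h3
      rwa [← Module.End.mul_apply, ← Module.End.mul_apply, ← map_mul, ← map_mul, mul_inv_cancel,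
        map_one, Module.End.one_apply, ← pow_two] at this
    have h5 : ρ t y = y := by
      obtain ⟨m, rfl⟩ := hodd
      refine fixed_of_pow_fixed (k := m + 1) ?_ h4
      rw [← pow_mul, show 2 * (m + 1) = (2 * m + 1) + 1 by ring, pow_succ, ht, one_mul]
    have hy : y = 0 := eq_zero_of_sum_of_fixed hr hy2 h5
    subst hy
    rw [map_zero, add_zero] at h1
    subst h1
    rfl
  have := LinearMap.finrank_le_finrank_of_injective hf
  rw [Module.finrank_prod] at this
  omega

/-- Three translates of the normalized fixed space of an element squaring `t` of order seven
are independent. -/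
theorem three_mul_finrank_normalizedFixed [FiniteDimensional F M] {ρ : Representation F G M}
    {w t : G} (hr : ((7 : ℕ) : F) ≠ 0) (ht : t ^ 7 = 1) (hk : w * t = t ^ 2 * w) :
    3 * finrank F (normalizedFixed ρ w t 7) ≤ finrank F M := by
  set N := normalizedFixed ρ w t 7
  have hcomp : ∀ g h (v : M), ρ g (ρ h v) = ρ (g * h) v := fun g h v => by
    rw [map_mul, Module.End.mul_apply]
  let f : N × N × N →ₗ[F] M := N.subtype.coprod
    (((ρ t).comp N.subtype).coprod ((ρ (t ^ 6)).comp N.subtype))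
  have hf : Function.Injective f := by
    rw [injective_iff_map_eq_zero]
    rintro ⟨⟨x, hx1, hx2⟩, ⟨y, hy1, hy2⟩, ⟨z, hz1, hz2⟩⟩ h
    have h1 : x + (ρ t y + ρ (t ^ 6) z) = 0 := h
    have hwt : ∀ i, w * t ^ i = t ^ (2 * i) * w := by
      intro i
      induction i with
      | zero => simp
      | succ i ih => rw [pow_succ, ← mul_assoc, ih, mul_assoc, hk, ← mul_assoc, ← pow_add,
          Nat.mul_succ]
    have hw : ∀ i v, ρ w v = v → ρ w (ρ (t ^ i) v) = ρ (t ^ (2 * i)) v := by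
      intro i v hv
      rw [hcomp, hwt, ← hcomp, hv]
    have h2 : x + (ρ (t ^ 2) y + ρ (t ^ 5) z) = 0 := by
      have := congrArg (ρ w) h1
      have e1 := hw 1 y hy1
      have e2 := hw 6 z hz1
      rw [pow_one] at e1
      rw [map_add, map_add, hx1, map_zero, e1, e2] at this
      rwa [show 2 * 6 = 7 + 5 by rfl, pow_add, ht, one_mul] at this
    have h3 : x + (ρ (t ^ 4) y + ρ (t ^ 3) z) = 0 := by
      have := congrArg (ρ w) h2
      rw [map_add, map_add, hx1, map_zero, hw 2 y hy1, hw 5 z hz1] at this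
      rwa [show 2 * 5 = 7 + 3 by rfl, pow_add, ht, one_mul] at this
    have hker : ∀ i j, ∑ n ∈ Finset.range 7, ρ (t ^ n) (ρ (t ^ i) y - ρ (t ^ j) z) = 0 := by
      intro i j
      simp only [map_sub, Finset.sum_sub_distrib]
      rw [sum_pow_apply _ ((Commute.refl t).pow_left i) hy2,
        sum_pow_apply _ ((Commute.refl t).pow_left j) hz2, sub_zero]
    have e1 : ρ t y = ρ (t ^ 5) z := by
      refine sub_eq_zero.1 (eq_zero_of_sum_of_fixed hr (by simpa using hker 1 5) ?_)
      rw [map_sub, hcomp, hcomp, ← pow_succ', ← pow_two]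
      have : ρ (t ^ 2) y + ρ (t ^ 5) z = ρ t y + ρ (t ^ 6) z :=
        add_left_cancel (h2.trans h1.symm)
      rw [sub_eq_sub_iff_add_eq_add, this]
    have e2 : ρ (t ^ 2) y = ρ (t ^ 3) z := by
      refine sub_eq_zero.1 (eq_zero_of_sum_of_fixed hr (hker 2 3) ?_)
      apply fixed_of_pow_fixed (j := 2) (k := 4)
      · rw [← pow_mul, show 2 * 4 = 7 + 1 by rfl, pow_add, ht, one_mul, pow_one]
      rw [map_sub, hcomp, hcomp, ← pow_add, ← pow_add]
      have : ρ (t ^ 4) y + ρ (t ^ 3) z = ρ (t ^ 2) y + ρ (t ^ 5) z :=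
        add_left_cancel (h3.trans h2.symm)
      rw [sub_eq_sub_iff_add_eq_add, this]
    have hz : z = 0 := by
      apply eq_zero_of_sum_of_fixed hr hz2
      apply fixed_of_pow_fixed (j := 3) (k := 5)
      · rw [← pow_mul, show 3 * 5 = 7 + (7 + 1) by rfl, pow_add, pow_add, ht, one_mul, one_mul,
          pow_one]
      have := congrArg (ρ t) e1
      rw [hcomp, hcomp, ← pow_two, ← pow_succ', e2] at this
      have := congrArg (ρ (t ^ 4)) this
      rw [hcomp, hcomp, ← pow_add, ← pow_add, ht, map_one, Module.End.one_apply] at this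
      rw [show 4 + (5 + 1) = 7 + 3 by rfl, pow_add, ht, one_mul] at this
      exact this.symm
    subst hz
    have hy : y = 0 := by
      rw [map_zero] at e1
      have := congrArg (ρ t⁻¹) e1
      rwa [hcomp, inv_mul_cancel, map_one, Module.End.one_apply, map_zero] at this
    subst hy
    simp only [map_zero, add_zero] at h1
    subst h1
    rfl
  have := LinearMap.finrank_le_finrank_of_injective hf
  rw [Module.finrank_prod, Module.finrank_prod] at this
  omega

end FixedPoints

section Weights

/-- Commuting operators preserving `W` and `D` have a joint eigenvector in `W` modulo `D`. -/
theorem exists_joint_eigenvector {F E ι : Type} [Field F] [IsAlgClosed F] [AddCommGroup E]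
    [Module F E] [FiniteDimensional F E] (f : ι → End F E) (hf : ∀ i j x, f i (f j x) = f j (f i x))
    (D : Submodule F E) (hD : ∀ i, ∀ x ∈ D, f i x ∈ D) :
    ∀ (n : ℕ) (W : Submodule F E), finrank F W = n → (∀ i, ∀ x ∈ W, f i x ∈ W) → ¬ W ≤ D →
      ∃ x ∈ W, x ∉ D ∧ ∀ i, ∃ μ : F, f i x - μ • x ∈ D := by
  intro n
  induction n using Nat.strong_induction_on with
  | _ n ih =>
  intro W hn hW hWD
  by_cases hall : ∀ i, ∃ μ : F, ∀ x ∈ W, f i x - μ • x ∈ D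
  · obtain ⟨x, hx, hxD⟩ := SetLike.not_le_iff_exists.1 hWD
    exact ⟨x, hx, hxD, fun i => (hall i).imp fun μ h => h x hx⟩
  push Not at hall
  obtain ⟨i, hi⟩ := hall
  let D' : Submodule F W := D.comap W.subtype
  let g : End F W := (f i).restrict (hW i)
  have hg : D' ≤ D'.comap g := fun x hx => hD i _ hx
  have hne : Nontrivial (W ⧸ D') := by
    rw [Submodule.Quotient.nontrivial_iff]
    intro h
    apply hWD
    intro x hx
    have : (⟨x, hx⟩ : W) ∈ D' := h ▸ Submodule.mem_top
    exact this
  obtain ⟨μ, hμ⟩ := Module.End.exists_eigenvalue (D'.mapQ D' g hg)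
  obtain ⟨y, hy⟩ := hμ.exists_hasEigenvector
  obtain ⟨x, rfl⟩ := D'.mkQ_surjective y
  have hx1 : f i x.1 - μ • x.1 ∈ D := by
    have h1 := hy.apply_eq_smul
    rw [Submodule.mkQ_apply, Submodule.mapQ_apply, ← Submodule.Quotient.mk_smul,
      Submodule.Quotient.eq] at h1
    exact h1
  have hx2 : x.1 ∉ D := by
    intro h
    apply hy.2
    rw [Submodule.mkQ_apply, Submodule.Quotient.mk_eq_zero]
    exact h
  let W' : Submodule F E := W ⊓ D.comap (f i - algebraMap F (End F E) μ)
  have hmem : ∀ z, z ∈ W' ↔ z ∈ W ∧ f i z - μ • z ∈ D := by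
    intro z
    simp [W', Submodule.mem_inf, Submodule.mem_comap]
  have hlt : finrank F W' < n := by
    rw [← hn]
    apply Submodule.finrank_lt_finrank_of_lt
    refine lt_of_le_of_ne inf_le_left ?_
    intro h
    obtain ⟨z, hz, hz'⟩ := hi μ
    rw [← h] at hz
    exact hz' ((hmem z).1 hz).2
  have hstable : ∀ j, ∀ z ∈ W', f j z ∈ W' := by
    intro j z hz
    rw [hmem] at hz ⊢
    refine ⟨hW j z hz.1, ?_⟩
    have := hD j _ hz.2
    rwa [map_sub, map_smul, hf j i] at this
  obtain ⟨z, hz, h⟩ := ih _ hlt W' rfl hstable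
    (fun h => hx2 (h ((hmem _).2 ⟨x.2, hx1⟩)))
  exact ⟨z, ((hmem z).1 hz).1, h⟩

theorem smul_sub_smul_mem {F E : Type} [Field F] [AddCommGroup E] [Module F E]
    (D : Submodule F E) (r : F) {x y : E} (h : x - y ∈ D) : r • x - r • y ∈ D := by
  rw [← smul_sub]
  exact D.smul_mem r h

theorem eq_of_smul_sub_smul_mem {F E : Type} [Field F] [AddCommGroup E] [Module F E]
    {D : Submodule F E} {x : E} (hx : x ∉ D) {r s : F} (h : r • x - s • x ∈ D) : r = s := by
  rw [← sub_smul] at h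
  by_contra hne
  exact hx ((D.smul_mem_iff (sub_ne_zero.2 hne)).1 h)

variable {F G M A : Type} [Field F] [Group G] [AddCommGroup M] [Module F M] [CommGroup A]

/-- The weight space of a character. -/
def weightSpace (ρ : Representation F G M) (θ : A →* G) (χ : A →* F) : Submodule F M where
  carrier := {v | ∀ a, ρ (θ a) v = χ a • v}
  add_mem' := by
    intro x y hx hy a
    rw [map_add, hx, hy, smul_add]
  zero_mem' := by intro a; simp
  smul_mem' := by
    intro r x hx a
    rw [map_smul, hx, smul_comm]

theorem char_mul_inv (χ : A →* F) (a : A) : χ a * χ a⁻¹ = 1 := by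
  rw [← map_mul, mul_inv_cancel, map_one]

variable [Fintype A]

/-- The projection onto a weight space, up to the factor `|A|`. -/
noncomputable def weightProj (ρ : Representation F G M) (θ : A →* G) (χ : A →* F) : M →ₗ[F] M :=
  ∑ a, χ a⁻¹ • ρ (θ a)

theorem weightProj_apply (ρ : Representation F G M) (θ : A →* G) (χ : A →* F) (v : M) :
    weightProj ρ θ χ v = ∑ a, χ a⁻¹ • ρ (θ a) v := by
  simp [weightProj]

theorem weightProj_mem (ρ : Representation F G M) (θ : A →* G) (χ : A →* F) (v : M) :
    weightProj ρ θ χ v ∈ weightSpace ρ θ χ := by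
  intro b
  rw [weightProj_apply, map_sum, Finset.smul_sum]
  refine Fintype.sum_equiv (Equiv.mulLeft b) _ _ (fun a => ?_)
  simp only [Equiv.coe_mulLeft, map_mul, mul_inv, smul_smul, map_smul, Module.End.mul_apply]
  rw [← mul_assoc, char_mul_inv, one_mul]

theorem weightProj_of_mem {ρ : Representation F G M} {θ : A →* G} {χ : A →* F} {v : M}
    (hv : v ∈ weightSpace ρ θ χ) : weightProj ρ θ χ v = (Fintype.card A : F) • v := by
  rw [weightProj_apply]
  have : ∀ a, χ a⁻¹ • ρ (θ a) v = v := by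
    intro a
    rw [hv a, smul_smul, mul_comm, char_mul_inv, one_smul]
  simp only [this, Finset.sum_const, Finset.card_univ, Nat.cast_smul_eq_nsmul]

theorem weightProj_of_mem_of_ne {ρ : Representation F G M} {θ : A →* G} {χ χ' : A →* F} {v : M}
    (hv : v ∈ weightSpace ρ θ χ') (hne : χ ≠ χ') : weightProj ρ θ χ v = 0 := by
  obtain ⟨b, hb⟩ : ∃ b, χ b ≠ χ' b := by
    by_contra! h
    exact hne (MonoidHom.ext h)
  have h1 := weightProj_mem ρ θ χ v b
  have h2 : ρ (θ b) (weightProj ρ θ χ v) = χ' b • weightProj ρ θ χ v := by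
    rw [weightProj_apply, map_sum, Finset.smul_sum]
    refine Finset.sum_congr rfl fun a _ => ?_
    rw [map_smul, ← Module.End.mul_apply, ← map_mul, ← map_mul, mul_comm b a, map_mul, map_mul,
      Module.End.mul_apply, hv b, map_smul, smul_comm]
  rw [h2, ← sub_eq_zero, ← sub_smul, smul_eq_zero, sub_eq_zero] at h1
  exact h1.resolve_left (fun h => hb h.symm)

/-- Weight spaces of distinct characters are independent. -/
theorem sum_finrank_weightSpace_le [FiniteDimensional F M] (hA : (Fintype.card A : F) ≠ 0)
    (ρ : Representation F G M) (θ : A →* G) {ι : Type} [Fintype ι] (χ : ι → (A →* F))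
    (hχ : Function.Injective χ) :
    ∑ i, finrank F (weightSpace ρ θ (χ i)) ≤ finrank F M := by
  classical
  let f : (∀ i, weightSpace ρ θ (χ i)) →ₗ[F] M :=
    ∑ i, (weightSpace ρ θ (χ i)).subtype.comp (LinearMap.proj i)
  have hfa : ∀ x, f x = ∑ i, (x i).1 := fun x => by simp [f]
  have hf : Function.Injective f := by
    rw [injective_iff_map_eq_zero]
    intro x hx
    funext i
    have h1 := congrArg (weightProj ρ θ (χ i)) hx
    rw [hfa, map_sum, map_zero, Finset.sum_eq_single i, weightProj_of_mem (x i).2] at h1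
    · exact Subtype.ext ((smul_eq_zero.1 h1).resolve_left hA)
    · intro j _ hj
      exact weightProj_of_mem_of_ne (x j).2 (fun h => hj (hχ h).symm)
    · simp
  have := LinearMap.finrank_le_finrank_of_injective hf
  rwa [Module.finrank_pi_fintype] at this

omit [Fintype A] in
theorem finrank_weightSpace_le_of_conj [FiniteDimensional F M]
    (ρ : Representation F G M) (θ : A →* G) {χ χ' : A →* F} (g : G)
    (h : ∀ b, ∃ a, θ b * g = g * θ a ∧ χ' b = χ a) :
    finrank F (weightSpace ρ θ χ) ≤ finrank F (weightSpace ρ θ χ') := by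
  have hmap : ∀ v ∈ weightSpace ρ θ χ, ρ g v ∈ weightSpace ρ θ χ' := by
    intro v hv b
    obtain ⟨a, hab, hχ⟩ := h b
    rw [← Module.End.mul_apply, ← map_mul, hab, map_mul, Module.End.mul_apply, hv a, hχ, map_smul]
  apply LinearMap.finrank_le_finrank_of_injective (f := (ρ g).restrict hmap)
  rw [injective_iff_map_eq_zero]
  rintro ⟨x, hx⟩ h0
  have h1 : ρ g x = 0 := congrArg Subtype.val h0
  have h2 := congrArg (ρ g⁻¹) h1
  rw [← Module.End.mul_apply, ← map_mul, inv_mul_cancel, map_one, map_zero] at h2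
  exact Subtype.ext h2

/-- A cocycle vanishing on `A` vanishes on a unipotent subgroup normalized by `A` as soon as the
relevant weight components at a generator vanish. -/
theorem cocycleSpace_eq_zero_of_weightProj {p : ℕ} [Fact p.Prime] [CharP F p] [IsAlgClosed F]
    [FiniteDimensional F M] (hA : (Fintype.card A : F) ≠ 0)
    {ρ : Representation F G M} {θ : A →* G} {V : Type} [AddCommGroup V] (υ : V → G)
    (hadd : ∀ x y, υ (x + y) = υ x * υ y) (hpow : ∀ x, υ x ^ p = 1) (α : A → V → V)
    (hα : ∀ a x, θ a * υ x = υ (α a x) * θ a) (u : V)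
    (hu : AddSubgroup.closure (Set.range fun a => α a u) = ⊤)
    {ι : Type} (χ : ι → (A →* F))
    (hχ : ∀ ψ : A →* F, (∃ φ : V →+ F, φ ≠ 0 ∧ ∀ a x, φ (α a x) = ψ a * φ x) → ∃ i, χ i = ψ)
    {c : G → M} (hc : c ∈ cocycleSpace ρ) (hcA : ∀ a, c (θ a) = 0)
    (h0 : ∀ i, weightProj ρ θ (χ i) (c (υ u)) = 0) (x : V) : c (υ x) = 0 := by
  let D : Submodule F (M →ₗ[F] F) :=
    { carrier := {ψ | ∀ x, ψ (c (υ x)) = 0}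
      add_mem' := by
        intro a b ha hb x
        rw [LinearMap.add_apply, ha, hb, add_zero]
      zero_mem' := by intro x; rfl
      smul_mem' := by
        intro r a ha x
        rw [LinearMap.smul_apply, ha, smul_zero] }
  have hcα : ∀ a x, c (υ (α a x)) = ρ (θ a) (c (υ x)) := by
    intro a x
    have h1 := hc (θ a) (υ x)
    rw [hα, hc _ (θ a), hcA, map_zero, zero_add, add_zero] at h1
    exact h1
  have hcadd : ∀ x y, c (υ (x + y)) = ρ (υ x) (c (υ y)) + c (υ x) := by
    intro x y
    rw [hadd, hc]
  let R : G → End F (M →ₗ[F] F) := fun g => LinearMap.lcomp F F (ρ g)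
  have hR : ∀ g ψ v, R g ψ v = ψ (ρ g v) := fun g ψ v => rfl
  have hRm : ∀ g h ψ, R g (R h ψ) = R (h * g) ψ := by
    intro g h ψ
    ext v
    rw [hR, hR, hR, map_mul, Module.End.mul_apply]
  have hDU : ∀ x, ∀ ψ ∈ D, R (υ x) ψ ∈ D := by
    intro x ψ hψ y
    rw [hR, eq_sub_of_add_eq (hcadd x y).symm, map_sub, hψ, hψ, sub_zero]
  have hDA : ∀ a, ∀ ψ ∈ D, R (θ a) ψ ∈ D := by
    intro a ψ hψ y
    rw [hR, ← hcα, hψ]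
  have hUcomm : ∀ x y, υ x * υ y = υ y * υ x := fun x y => by rw [← hadd, add_comm, hadd]
  suffices hDtop : (⊤ : Submodule F (M →ₗ[F] F)) ≤ D by
    rw [← Module.forall_dual_apply_eq_zero_iff F]
    intro ψ
    exact hDtop (Submodule.mem_top (x := ψ)) x
  by_contra hDtop
  -- functionals invariant under the unipotent group modulo `D`
  let W : Submodule F (M →ₗ[F] F) :=
    { carrier := {ψ | ∀ x, R (υ x) ψ - ψ ∈ D}
      add_mem' := by
        intro a b ha hb x
        rw [map_add, add_sub_add_comm]
        exact D.add_mem (ha x) (hb x)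
      zero_mem' := by intro x; rw [map_zero, sub_zero]; exact D.zero_mem
      smul_mem' := by
        intro r a ha x
        rw [map_smul]
        exact smul_sub_smul_mem D r (ha x) }
  have hWD : ¬ W ≤ D := by
    obtain ⟨ψ, -, hψ, hl⟩ := exists_joint_eigenvector (fun x => R (υ x))
      (fun x y ψ => by simp only [hRm, hUcomm x y]) D hDU _ ⊤ rfl (fun _ _ _ => Submodule.mem_top)
      hDtop
    intro hle
    apply hψ
    apply hle
    intro x
    obtain ⟨μ, hμ⟩ := hl x
    have hpw : ∀ n : ℕ, R (υ x ^ n) ψ - μ ^ n • ψ ∈ D := by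
      intro n
      induction n with
      | zero =>
        have : R 1 ψ = ψ := by ext v; rw [hR, map_one, Module.End.one_apply]
        rw [pow_zero, pow_zero, this, one_smul, sub_self]
        exact D.zero_mem
      | succ n ih =>
        have h1 := hDU x _ ih
        rw [map_sub, map_smul, hRm, ← pow_succ] at h1
        have h2 := D.add_mem h1 (D.smul_mem (μ ^ n) hμ)
        rw [smul_sub, smul_smul, ← pow_succ] at h2
        convert h2 using 1
        abel
    have h1 := hpw p
    rw [hpow] at h1
    have h2 : R 1 ψ = ψ := by ext v; rw [hR, map_one, Module.End.one_apply]
    have h3 : (1 : F) • ψ - μ ^ p • ψ ∈ D := by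
      rw [one_smul]; rwa [h2] at h1
    have h4 : 1 - μ ^ p = 0 := sub_eq_zero.2 (eq_of_smul_sub_smul_mem hψ h3)
    have h5 : μ = 1 := by
      have h6 : (1 - μ) ^ p = 0 := by rw [sub_pow_char, one_pow, h4]
      exact (sub_eq_zero.1 (pow_eq_zero_iff (Fact.out : p.Prime).ne_zero |>.1 h6)).symm
    rw [h5, one_smul] at hμ
    exact hμ
  obtain ⟨ψ, hψW, hψD, hl⟩ := exists_joint_eigenvector (fun a => R (θ a))
    (fun a b ψ => by simp only [hRm, ← map_mul, mul_comm a b]) D hDA _ W rfl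
    (by
      intro a ψ hψ x y
      rw [LinearMap.sub_apply, hR, hR, hR, ← map_sub, ← Module.End.mul_apply, ← map_mul, hα,
        map_mul, Module.End.mul_apply, ← hcα]
      have h1 := hψ (α a x) (α a y)
      rw [LinearMap.sub_apply, hR] at h1
      rw [map_sub]
      exact h1) hWD
  choose lam hlam using hl
  have huniq : ∀ r s : F, r • ψ - s • ψ ∈ D → r = s := by
    intro r s h
    exact eq_of_smul_sub_smul_mem hψD h
  have hR1 : R 1 ψ = ψ := by ext v; rw [hR, map_one, Module.End.one_apply]
  let κ : A →* F :=
    { toFun := lam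
      map_one' := by
        have h1 := hlam 1
        simp only [map_one] at h1
        rw [hR1] at h1
        refine (huniq 1 (lam 1) ?_).symm
        rwa [one_smul]
      map_mul' := by
        intro a b
        have h1 := hDA b _ (hlam a)
        rw [map_sub, map_smul, hRm, ← map_mul] at h1
        have h2 := D.add_mem h1 (D.smul_mem (lam a) (hlam b))
        rw [smul_sub, smul_smul, sub_add_sub_cancel] at h2
        refine huniq _ _ ?_
        have h3 := D.sub_mem h2 (hlam (a * b))
        rwa [sub_sub_sub_cancel_left] at h3 }
  let φ : V →+ F :=
    { toFun := fun x => ψ (c (υ x))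
      map_zero' := by
        have := hcadd 0 0
        have h1 : υ 0 = 1 := by
          have := hadd 0 0
          rw [add_zero] at this
          exact (left_eq_mul.1 this)
        rw [h1, cocycleSpace_one hc, map_zero]
      map_add' := by
        intro x y
        rw [hcadd, map_add]
        have := hψW x y
        rw [LinearMap.sub_apply, hR, sub_eq_zero] at this
        rw [this, add_comm] }
  have hφα : ∀ a x, φ (α a x) = κ a * φ x := by
    intro a x
    have h1 := hlam a x
    rw [LinearMap.sub_apply, hR, sub_eq_zero] at h1
    change ψ (c (υ (α a x))) = lam a * ψ (c (υ x))
    rw [hcα, h1]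
    rfl
  have hφ0 : φ ≠ 0 := by
    intro h
    exact hψD fun x => DFunLike.congr_fun h x
  obtain ⟨i, hi⟩ := hχ κ ⟨φ, hφ0, hφα⟩
  have h1 := congrArg ψ (h0 i)
  rw [hi, weightProj_apply, map_sum, map_zero] at h1
  have h2 : ∀ a, ψ (κ a⁻¹ • ρ (θ a) (c (υ u))) = φ u := by
    intro a
    rw [map_smul, ← hcα]
    change κ a⁻¹ * φ (α a u) = _
    rw [hφα, ← mul_assoc, mul_comm (κ a⁻¹), char_mul_inv, one_mul]
  simp only [h2, Finset.sum_const, Finset.card_univ, nsmul_eq_mul] at h1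
  have hu0 : φ u = 0 := (mul_eq_zero.1 h1).resolve_left hA
  apply hφ0
  ext x
  have hx : x ∈ AddSubgroup.closure (Set.range fun a => α a u) := hu ▸ AddSubgroup.mem_top x
  induction hx using AddSubgroup.closure_induction with
  | mem y hy =>
    obtain ⟨a, rfl⟩ := hy
    simp [hφα, hu0]
  | zero => simp
  | add y z _ _ hy hz => rw [map_add, hy, hz]; simp
  | neg y _ hy => rw [map_neg, hy]; simp

end Weights

section WeightBound

variable {F G M A : Type} [Field F] [Group G] [AddCommGroup M] [Module F M] [CommGroup A]
  [Fintype A]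

/-- Bounding the first cohomology by the weight components detecting normalized cocycles. -/
theorem finrank_groupCohomology_le_sum_weightSpace [Finite G] [FiniteDimensional F M]
    (ρ : Representation F G M) (hinv : ∀ v, (∀ g, ρ g v = v) → v = 0)
    (hA : (Fintype.card A : F) ≠ 0) (θ : A →* G) (w : G)
    (hw : ∀ a', ∃ a, w * θ a = θ a' * w) {ι : Type} [Fintype ι] (χ : ι → (A →* F)) (g : ι → G)
    (h : ∀ c ∈ cocycleSpace ρ, (∀ a, c (θ a) = 0) → c w = 0 →
      (∀ i, weightProj ρ θ (χ i) (c (g i)) = 0) → c = 0) :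
    finrank F (groupCohomology (Rep.of ρ) 1) ≤ ∑ i, finrank F (weightSpace ρ θ (χ i)) := by
  let T : (G → M) →ₗ[F] (∀ i, weightSpace ρ θ (χ i)) :=
    LinearMap.pi fun i => ((weightProj ρ θ (χ i)).codRestrict _ (weightProj_mem ρ θ (χ i))).comp
      (LinearMap.proj (g i))
  have := finrank_groupCohomology_le ρ hinv hA θ w hw T ⊤ (fun c hc hcA hcw hT => by
    refine h c hc hcA hcw fun i => ?_
    exact congrArg Subtype.val (congrFun hT i)) (fun _ _ _ _ => Submodule.mem_top)
  rwa [finrank_top, Module.finrank_pi_fintype] at this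

/-- A multiplicative weight of an additive map on a vector space is induced by a ring
homomorphism. -/
theorem exists_ringHom_of_weight {L V : Type} [CommRing L] [AddCommGroup V] [Module L V]
    {φ : V →+ F} (hφ : φ ≠ 0) (S : Set L) (hS : Subring.closure S = ⊤)
    (h : ∀ s ∈ S, ∃ r, ∀ v, φ (s • v) = r * φ v) :
    ∃ σ : L →+* F, ∀ s v, φ (s • v) = σ s * φ v := by
  obtain ⟨v₀, hv₀⟩ : ∃ v, φ v ≠ 0 := by
    by_contra! h'
    exact hφ (AddMonoidHom.ext h')
  have hall : ∀ s : L, ∃ r, ∀ v, φ (s • v) = r * φ v := by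
    intro s
    have hs : s ∈ Subring.closure S := hS ▸ Subring.mem_top s
    induction hs using Subring.closure_induction with
    | mem x hx => exact h x hx
    | zero => exact ⟨0, fun v => by simp⟩
    | one => exact ⟨1, fun v => by simp⟩
    | add x y _ _ hx hy =>
      obtain ⟨a, ha⟩ := hx
      obtain ⟨b, hb⟩ := hy
      exact ⟨a + b, fun v => by rw [add_smul, map_add, ha, hb, add_mul]⟩
    | neg x _ hx =>
      obtain ⟨a, ha⟩ := hx
      exact ⟨-a, fun v => by rw [neg_smul, map_neg, ha, neg_mul]⟩
    | mul x y _ _ hx hy =>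
      obtain ⟨a, ha⟩ := hx
      obtain ⟨b, hb⟩ := hy
      exact ⟨a * b, fun v => by rw [mul_smul, ha, hb, mul_assoc]⟩
  choose σ hσ using hall
  refine ⟨{ toFun := σ, map_one' := ?_, map_mul' := ?_, map_zero' := ?_, map_add' := ?_ }, hσ⟩
  · have := hσ 1 v₀
    rw [one_smul] at this
    exact (mul_eq_right₀ hv₀).1 this.symm
  · intro x y
    refine mul_right_cancel₀ hv₀ ?_
    rw [← hσ, mul_smul, hσ, hσ, mul_assoc]
  · refine mul_right_cancel₀ hv₀ ?_
    rw [← hσ, zero_smul, map_zero, zero_mul]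
  · intro x y
    refine mul_right_cancel₀ hv₀ ?_
    rw [← hσ, add_smul, map_add, hσ, hσ, add_mul]

end WeightBound

section TrivialModule

variable {F G M : Type} [Field F] [Group G] [AddCommGroup M] [Module F M]

/-- Invariants of an irreducible representation of a perfect group: either there are none, or
the first cohomology vanishes. -/
theorem invariants_or_finrank_eq_zero (ρ : Representation F G M)
    (hperf : ∀ f : G →* Multiplicative M, ∀ g, f g = 1)
    (hirred : ∀ P : Submodule F M, (∀ (g : G) (x : M), x ∈ P → ρ g x ∈ P) → P = ⊥ ∨ P = ⊤) :
    (∀ v, (∀ g, ρ g v = v) → v = 0) ∨ finrank F (groupCohomology (Rep.of ρ) 1) = 0 := by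
  let P : Submodule F M :=
    { carrier := {v | ∀ g, ρ g v = v}
      add_mem' := by
        intro a b ha hb g
        rw [map_add, ha, hb]
      zero_mem' := by intro g; simp
      smul_mem' := by
        intro r a ha g
        rw [map_smul, ha] }
  rcases hirred P (fun g x hx h => by rw [hx g, hx h]) with hP | hP
  · left
    intro v hv
    have : v ∈ P := hv
    rwa [hP, Submodule.mem_bot] at this
  · right
    have htriv : ∀ g v, ρ g v = v := fun g v => by
      have : v ∈ P := hP ▸ Submodule.mem_top
      exact this g
    obtain ⟨f, hf, -⟩ := exists_cocycleSpace_surjection ρ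
    have h0 : ∀ c : cocycleSpace ρ, c = 0 := by
      rintro ⟨c, hc⟩
      apply Subtype.ext
      funext g
      let φ : G →* Multiplicative M :=
        { toFun := fun g => Multiplicative.ofAdd (c g)
          map_one' := by rw [cocycleSpace_one hc]; rfl
          map_mul' := by
            intro x y
            rw [hc, htriv, add_comm, ofAdd_add] }
      exact Multiplicative.ofAdd.injective (hperf φ g)
    have : Subsingleton (groupCohomology (Rep.of ρ) 1) := by
      constructor
      intro x y
      obtain ⟨a, rfl⟩ := hf x
      obtain ⟨b, rfl⟩ := hf y
      rw [h0 a, h0 b]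
    exact finrank_zero_of_subsingleton

end TrivialModule

section SpecialLinear

open Matrix

variable {ι K : Type} [Fintype ι] [DecidableEq ι] [Field K]

local notation "SLn" => Matrix.SpecialLinearGroup ι K

theorem specialLinearGroup_ext {g h : SLn} (e : (g : Matrix ι ι K) = h) : g = h :=
  Subtype.ext e

theorem transvection_commutator {i j k : ι} (hik : i ≠ k) (hkj : k ≠ j) (hij : i ≠ j) (x y : K) :
    (SpecialLinearGroup.transvection hik x * SpecialLinearGroup.transvection hkj y *
      (SpecialLinearGroup.transvection hik x)⁻¹ * (SpecialLinearGroup.transvection hkj y)⁻¹ : SLn) =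
    SpecialLinearGroup.transvection hij (x * y) := by
  rw [SpecialLinearGroup.transvection_inv, SpecialLinearGroup.transvection_inv]
  apply specialLinearGroup_ext
  simp [SpecialLinearGroup.transvection_coe, mul_add, add_mul, single_mul_single_same,
    single_mul_single_of_ne, hik.symm, hkj.symm, hij.symm, ← single_neg]
  abel

/-- The relation of being joined by a full root subgroup inside `H`. -/
def RootJoined (H : Subgroup SLn) (i j : ι) : Prop :=
  ∀ h : i ≠ j, ∀ x, SpecialLinearGroup.transvection h x ∈ H

theorem RootJoined.trans {H : Subgroup SLn} {i k j : ι} (h1 : RootJoined H i k)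
    (h2 : RootJoined H k j) : RootJoined H i j := by
  intro h x
  by_cases hik : i = k
  · subst hik; exact h2 h x
  by_cases hkj : k = j
  · subst hkj; exact h1 h x
  rw [← mul_one x, ← transvection_commutator hik hkj h x 1]
  exact H.mul_mem (H.mul_mem (H.mul_mem (h1 _ _) (h2 _ _)) (H.inv_mem (h1 _ _)))
    (H.inv_mem (h2 _ _))

theorem weyl_mul {i j : ι} (h : i ≠ j) {a : K} (ha : a ≠ 0) :
    ((SpecialLinearGroup.transvection h a * SpecialLinearGroup.transvection h.symm (-a⁻¹) *
      SpecialLinearGroup.transvection h a : SLn) : Matrix ι ι K) =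
    1 - single i i 1 - single j j 1 + single i j a - single j i a⁻¹ := by
  simp [SpecialLinearGroup.transvection_coe, mul_add, add_mul, single_mul_single_same,
    single_mul_single_of_ne, h.symm, ← single_neg, ha]
  abel

theorem diag2n_eq {i j : ι} (h : i ≠ j) {a : K} (ha : a ≠ 0) :
    (SpecialLinearGroup.diag2n h a ha : SLn) =
      (SpecialLinearGroup.transvection h a * SpecialLinearGroup.transvection h.symm (-a⁻¹) *
      SpecialLinearGroup.transvection h a) *
      (SpecialLinearGroup.transvection h (-1) * SpecialLinearGroup.transvection h.symm (-(-1)⁻¹) *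
      SpecialLinearGroup.transvection h (-1)) := by
  apply specialLinearGroup_ext
  rw [Matrix.SpecialLinearGroup.coe_mul, weyl_mul h ha, weyl_mul h (neg_ne_zero.2 one_ne_zero),
    SpecialLinearGroup.diag2n_coe]
  have hd : (diagonal (fun k ↦ if k = i then a else if k = j then a⁻¹ else 1) : Matrix ι ι K) =
      1 - single i i 1 - single j j 1 + single i i a + single j j a⁻¹ := by
    ext k l
    rw [diagonal_apply]
    simp only [Matrix.add_apply, Matrix.sub_apply, single_apply, one_apply]
    grind
  rw [hd]
  simp [mul_add, add_mul, mul_sub, sub_mul, single_mul_single_same,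
    single_mul_single_of_ne, h, h.symm, ← single_neg]
  abel

theorem eq_top_of_transvections [Nontrivial ι] {H : Subgroup SLn} (hH : ∀ i j, RootJoined H i j) :
    H = ⊤ := by
  rw [eq_top_iff]
  intro g _
  refine SpecialLinearGroup.diagonal_transvection_induction' (· ∈ H) g ?_
    (fun i j h a => hH i j h a) (fun A B => H.mul_mem)
  intro i j h c hc
  rw [diag2n_eq h hc]
  refine H.mul_mem (H.mul_mem (H.mul_mem ?_ ?_) ?_) (H.mul_mem (H.mul_mem ?_ ?_) ?_)
  all_goals exact hH _ _ _ _

/-- A special linear matrix is monomial with permutation `π` and coefficients `ε`. -/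
def IsMonomial (π : Equiv.Perm ι) (ε : ι → Kˣ) (g : SLn) : Prop :=
  ∀ i j, g.1 i j = if i = π j then (ε j : K) else 0

theorem exists_isMonomial [Nonempty ι] (π : Equiv.Perm ι) : ∃ (g : SLn) (ε : ι → Kˣ),
    IsMonomial π ε g := by
  let i₀ : ι := Classical.arbitrary ι
  let s : Kˣ := Units.map (Int.castRingHom K).toMonoidHom (Equiv.Perm.sign π)
  let ε : ι → Kˣ := Function.update 1 i₀ s
  let N : Matrix ι ι K := Matrix.of fun i j => if i = π j then (ε j : K) else 0
  have hN : N = (Equiv.Perm.permMatrix K π)ᵀ * diagonal (fun j => (ε j : K)) := by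
    ext i j
    rw [mul_diagonal, transpose_apply, Equiv.Perm.permMatrix, PEquiv.toMatrix_apply]
    simp [N, eq_comm]
  have hdet : N.det = 1 := by
    rw [hN, det_mul, det_transpose, det_permutation, det_diagonal, Finset.prod_eq_single i₀]
    · have hs : (s : K) = ((Equiv.Perm.sign π : ℤ) : K) := rfl
      simp only [ε, Function.update_self, hs]
      rw [← Int.cast_mul, ← Units.val_mul, Int.units_mul_self, Units.val_one, Int.cast_one]
    · intro b _ hb
      simp [ε, Function.update_of_ne hb]
    · simp
  exact ⟨⟨N, hdet⟩, ε, fun i j => rfl⟩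

theorem IsMonomial.mul_transvection {π : Equiv.Perm ι} {ε : ι → Kˣ} {g : SLn}
    (hg : IsMonomial π ε g) {i j : ι} (h : i ≠ j) (x : K) :
    g * SpecialLinearGroup.transvection h x =
      SpecialLinearGroup.transvection (π.injective.ne h) (ε i * x * (ε j : K)⁻¹) * g := by
  apply specialLinearGroup_ext
  rw [Matrix.SpecialLinearGroup.coe_mul, Matrix.SpecialLinearGroup.coe_mul, SpecialLinearGroup.transvection_coe,
    SpecialLinearGroup.transvection_coe, mul_add, add_mul, mul_one, one_mul]
  congr 1
  ext k l
  by_cases hl : l = j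
  · subst hl
    rw [mul_single_apply_same, hg]
    by_cases hk : k = π i
    · subst hk
      rw [single_mul_apply_same, hg]
      simp [mul_assoc]
    · rw [single_mul_apply_of_ne _ _ _ _ _ hk]
      simp [hk]
  · rw [mul_single_apply_of_ne _ _ _ _ _ hl]
    by_cases hk : k = π i
    · subst hk
      rw [single_mul_apply_same, hg, if_neg, mul_zero]
      exact fun h => hl (π.injective h).symm
    · rw [single_mul_apply_of_ne _ _ _ _ _ hk]

/-- The diagonal torus of the special linear group. -/
def torus (ι K : Type) [Fintype ι] [Field K] : Subgroup (ι → Kˣ) where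
  carrier := {t | ∏ i, t i = 1}
  mul_mem' := by
    intro a b ha hb
    simp only [Set.mem_ofPred_eq] at ha hb
    simp [Finset.prod_mul_distrib, ha, hb]
  one_mem' := by simp
  inv_mem' := by
    intro a ha
    simp only [Set.mem_ofPred_eq] at ha
    simp [ha]

/-- The torus as diagonal matrices. -/
def torusHom : torus ι K →* SLn where
  toFun t := ⟨diagonal fun i => (t.1 i : K), by
    rw [det_diagonal, ← Units.coe_prod, t.2, Units.val_one]⟩
  map_one' := by
    apply specialLinearGroup_ext
    simp
  map_mul' := by
    intro s t
    apply specialLinearGroup_ext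
    change diagonal (fun i => ((s.1 i * t.1 i : Kˣ) : K)) =
      diagonal (fun i => (s.1 i : K)) * diagonal (fun i => (t.1 i : K))
    simp

theorem torusHom_mul_transvection (t : torus ι K) {i j : ι} (h : i ≠ j) (x : K) :
    torusHom t * SpecialLinearGroup.transvection h x =
      (SpecialLinearGroup.transvection h (t.1 i * (t.1 j : K)⁻¹ * x) : SLn) * torusHom t := by
  have hm : IsMonomial 1 t.1 (torusHom t : SLn) := by
    intro i j
    change diagonal (fun i => (t.1 i : K)) i j = _
    rw [diagonal_apply]
    by_cases hij : i = j <;> simp [hij]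
  rw [hm.mul_transvection h]
  congr 2
  ring

theorem IsMonomial.mul_torusHom {π : Equiv.Perm ι} {ε : ι → Kˣ} {g : SLn}
    (hg : IsMonomial π ε g) {s t : torus ι K} (hst : ∀ i, s.1 (π i) = t.1 i) :
    g * torusHom t = torusHom s * g := by
  apply specialLinearGroup_ext
  rw [Matrix.SpecialLinearGroup.coe_mul, Matrix.SpecialLinearGroup.coe_mul]
  ext i j
  change (g.1 * diagonal fun i => (t.1 i : K)) i j = ((diagonal fun i => (s.1 i : K)) * g.1) i j
  rw [mul_diagonal, diagonal_mul, hg]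
  split_ifs with h
  · rw [h, hst, mul_comm]
  · simp

/-- Transport of a torus element along a permutation. -/
def torusPerm (π : Equiv.Perm ι) (t : torus ι K) : torus ι K :=
  ⟨fun i => t.1 (π i), (Equiv.prod_comp π t.1).trans t.2⟩

end SpecialLinear

section SplitTorus

open Matrix

variable {ι K : Type} [Fintype ι] [DecidableEq ι] [Field K]

local notation "SLn" => Matrix.SpecialLinearGroup ι K

/-- The coroot element of the torus. -/
def corootElt {i j : ι} (h : i ≠ j) (a : Kˣ) : torus ι K :=
  ⟨Function.update (Function.update 1 j a⁻¹) i a, by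
    change ∏ k, Function.update (Function.update (1 : ι → Kˣ) j a⁻¹) i a k = 1
    rw [Finset.prod_update_of_mem (Finset.mem_univ _), Finset.prod_update_of_mem
      (by simp [h.symm])]
    simp⟩

theorem corootElt_left {i j : ι} (h : i ≠ j) (a : Kˣ) : (corootElt h a).1 i = a := by
  simp [corootElt]

theorem corootElt_right {i j : ι} (h : i ≠ j) (a : Kˣ) : (corootElt h a).1 j = a⁻¹ := by
  simp [corootElt, h.symm]

theorem corootElt_of_ne {i j k : ι} (h : i ≠ j) (a : Kˣ) (hi : k ≠ i) (hj : k ≠ j) :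
    (corootElt h a).1 k = 1 := by
  simp [corootElt, hi, hj]

/-- The special linear group is perfect under mild hypotheses. -/
theorem hom_eq_one_of_commGroup [Nontrivial ι] {N : Type} [CommGroup N] (f : SLn →* N)
    (h : (∀ i j : ι, ∃ k, k ≠ i ∧ k ≠ j) ∨ ∃ a : Kˣ, a ^ 2 ≠ 1) (g : SLn) : f g = 1 := by
  have key : ∀ i j, RootJoined f.ker i j := by
    intro i j hij x
    rw [MonoidHom.mem_ker]
    rcases h with h | ⟨a, ha⟩
    · obtain ⟨k, hki, hkj⟩ := h i j
      rw [← mul_one x, ← transvection_commutator hki.symm hkj hij x 1]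
      simp only [map_mul, map_inv]
      rw [mul_right_comm (f _) (f _), mul_inv_cancel, one_mul, mul_inv_cancel]
    · have h0 : ((a : K) * a - 1) ≠ 0 := by
        intro h0
        refine ha (Units.ext ?_)
        rw [Units.val_pow_eq_pow_val, Units.val_one, pow_two]
        exact sub_eq_zero.1 h0
      have h1 := congrArg f (torusHom_mul_transvection (corootElt hij a) hij
        (((a : K) ^ 2 - 1)⁻¹ * x))
      rw [corootElt_left, corootElt_right, map_mul, map_mul, mul_comm] at h1
      have h2 := mul_right_cancel h1
      rw [← pow_two] at h0
      have h3 : x + ((a : K) ^ 2 - 1)⁻¹ * x =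
          (a * ((a⁻¹ : Kˣ) : K)⁻¹ * (((a : K) ^ 2 - 1)⁻¹ * x)) := by
        rw [Units.val_inv_eq_inv_val, inv_inv]
        field_simp
        ring
      rw [← h3, SpecialLinearGroup.transvection_add, map_mul] at h2
      exact (right_eq_mul.1 h2)
  have := eq_top_of_transvections key
  rw [← MonoidHom.mem_ker, this]
  exact Subgroup.mem_top g

theorem transvection_pow {i j : ι} (h : i ≠ j) (x : K) (n : ℕ) :
    (SpecialLinearGroup.transvection h x : SLn) ^ n = SpecialLinearGroup.transvection h (n • x) := by
  induction n with
  | zero => rw [pow_zero, zero_smul, SpecialLinearGroup.transvection_coeff_zero]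
  | succ n ih => rw [pow_succ, ih, succ_nsmul, SpecialLinearGroup.transvection_add]

/-- The character of the torus obtained by applying a field embedding to a root. -/
def rootChar {F : Type} [Field F] (σ : K →+* F) (i j : ι) : torus ι K →* F where
  toFun t := σ ((t.1 i * (t.1 j)⁻¹ : Kˣ) : K)
  map_one' := by simp
  map_mul' s t := by
    rw [← map_mul, ← Units.val_mul]
    congr 2
    change s.1 i * t.1 i * (s.1 j * t.1 j)⁻¹ = _
    rw [mul_inv]
    exact mul_mul_mul_comm _ _ _ _

omit [Fintype ι] in
theorem exists_perm_apply_eq {i j k l : ι} (hij : i ≠ j) (hkl : k ≠ l) :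
    ∃ π : Equiv.Perm ι, π i = k ∧ π j = l := by
  refine ⟨(Equiv.swap i k).trans (Equiv.swap (Equiv.swap i k j) l), ?_, by simp⟩
  rw [Equiv.trans_apply, Equiv.swap_apply_left, Equiv.swap_apply_of_ne_of_ne _ hkl]
  intro h
  have := congrArg (Equiv.swap i k) h
  rw [Equiv.swap_apply_right, Equiv.swap_apply_self] at this
  exact hij this

omit [DecidableEq ι] in
/-- The torus has order prime to the characteristic. -/
theorem card_torus_ne_zero {p : ℕ} [Fact p.Prime] [Fintype K] [CharP K p] {F : Type} [Field F]
    [CharP F p] [Fintype (torus ι K)] : (Fintype.card (torus ι K) : F) ≠ 0 := by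
  rw [Ne, CharP.cast_eq_zero_iff F p]
  intro hdvd
  obtain ⟨t, ht⟩ := exists_prime_orderOf_dvd_card p hdvd
  have h1 : t ^ p = 1 := ht ▸ pow_orderOf_eq_one t
  have h2 : t = 1 := by
    apply Subtype.ext
    funext i
    have h3 : (t.1 i) ^ p = 1 := congrFun (congrArg Subtype.val h1) i
    have h4 : ((t.1 i : Kˣ) : K) ^ p = 1 ^ p := by
      rw [← Units.val_pow_eq_pow_val, h3]; simp
    exact Units.ext (frobenius_inj K p h4)
  rw [h2, orderOf_one] at ht
  exact (Fact.out : p.Prime).one_lt.ne ht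

variable [Fintype K] {F M : Type} [Field F] [IsAlgClosed F]
  [AddCommGroup M] [Module F M] [FiniteDimensional F M] [Fintype (K →+* F)]

theorem finrank_groupCohomology_le_sum_rootChar [Nontrivial ι] (p : ℕ) [Fact p.Prime]
    [CharP K p] [CharP F p]
    (ρ : Representation F SLn M) (hinv : ∀ v, (∀ g, ρ g v = v) → v = 0) (π : Equiv.Perm ι)
    (hπ : ∀ i j, ∃ n : ℕ, (π ^ n) i = j) (i₀ : ι) (hi₀ : i₀ ≠ π i₀)
    (hgen : Subring.closure (Set.range fun t : torus ι K =>
      ((t.1 i₀ * (t.1 (π i₀))⁻¹ : Kˣ) : K)) = ⊤) :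
    finrank F (groupCohomology (Rep.of ρ) 1) ≤
      ∑ σ : K →+* F, finrank F (weightSpace ρ torusHom (rootChar σ i₀ (π i₀))) := by
  classical
  let _ : Fintype (torus ι K) := Fintype.ofFinite _
  obtain ⟨w, ε, hw⟩ := exists_isMonomial (K := K) π
  have hA : (Fintype.card (torus ι K) : F) ≠ 0 := card_torus_ne_zero (p := p)
  refine finrank_groupCohomology_le_sum_weightSpace ρ hinv hA
    torusHom w (fun s => ⟨torusPerm π s, hw.mul_torusHom fun i => rfl⟩) _
    (fun _ => SpecialLinearGroup.transvection hi₀ (1 : K)) ?_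
  intro c hc hcA hcw h0
  have hroot : ∀ x : K, c (SpecialLinearGroup.transvection hi₀ x) = 0 := by
    intro x
    refine cocycleSpace_eq_zero_of_weightProj (p := p) hA
      (fun x : K => (SpecialLinearGroup.transvection hi₀ x : SLn))
      (fun x y => SpecialLinearGroup.transvection_add hi₀ x y) ?_
      (fun t x => ((t.1 i₀ * (t.1 (π i₀))⁻¹ : Kˣ) : K) * x) ?_ 1 ?_ (fun σ => rootChar σ i₀ (π i₀))
      ?_ hc hcA h0 x
    · intro x
      rw [transvection_pow, nsmul_eq_mul, CharP.cast_eq_zero, zero_mul,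
        SpecialLinearGroup.transvection_coeff_zero]
    · intro t x
      rw [torusHom_mul_transvection, Units.val_mul, Units.val_inv_eq_inv_val]
    · rw [eq_top_iff]
      intro y _
      have hy : y ∈ Subring.closure _ := hgen ▸ Subring.mem_top y
      rw [Subring.mem_closure_iff] at hy
      refine AddSubgroup.closure_mono ?_ hy
      let S : Submonoid K :=
        { carrier := Set.range fun t : torus ι K => ((t.1 i₀ * (t.1 (π i₀))⁻¹ : Kˣ) : K) * 1
          one_mem' := ⟨1, by simp⟩
          mul_mem' := by
            rintro _ _ ⟨s, rfl⟩ ⟨t, rfl⟩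
            refine ⟨s * t, ?_⟩
            simp only [mul_one]
            exact map_mul (rootChar (RingHom.id K) i₀ (π i₀)) s t }
      refine (Submonoid.closure_le (S := S)).2 ?_
      rintro _ ⟨t, rfl⟩
      exact ⟨t, mul_one _⟩
    · rintro ψ ⟨φ, hφ, h⟩
      obtain ⟨σ, hσ⟩ := exists_ringHom_of_weight hφ _ hgen (by
        rintro _ ⟨t, rfl⟩
        exact ⟨ψ t, h t⟩)
      refine ⟨σ, MonoidHom.ext fun t => ?_⟩
      obtain ⟨v, hv⟩ : ∃ v, φ v ≠ 0 := by
        by_contra! h'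
        exact hφ (AddMonoidHom.ext h')
      have h1 := h t v
      rw [← smul_eq_mul, hσ] at h1
      exact mul_right_cancel₀ hv h1
  refine cocycleSpace_eq_zero_of_closure hc (S := {g | c g = 0}) ?_ fun s hs => hs
  set H := Subgroup.closure {g : SLn | c g = 0} with hH
  have hwH : w ∈ H := Subgroup.subset_closure hcw
  have hstep : ∀ i, i ≠ π i → RootJoined H i (π i) → RootJoined H (π i) (π (π i)) := by
    intro i hne hi h x
    have h1 := hw.mul_transvection hne ((ε i : K)⁻¹ * x * ε (π i))
    have h2 : (ε i : K) * ((ε i : K)⁻¹ * x * ε (π i)) * (ε (π i) : K)⁻¹ = x := by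
      field_simp
    rw [h2] at h1
    rw [← mul_inv_eq_iff_eq_mul.2 h1]
    exact H.mul_mem (H.mul_mem hwH (hi hne _)) (H.inv_mem hwH)
  have hiter : ∀ n : ℕ, (π ^ n) i₀ ≠ π ((π ^ n) i₀) ∧ RootJoined H ((π ^ n) i₀)
      (π ((π ^ n) i₀)) := by
    intro n
    induction n with
    | zero => exact ⟨hi₀, fun h x => Subgroup.subset_closure (hroot x)⟩
    | succ n ih =>
      rw [pow_succ', Equiv.Perm.mul_apply]
      exact ⟨π.injective.ne ih.1, hstep _ ih.1 ih.2⟩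
  have hone : ∀ i, RootJoined H i (π i) := by
    intro i
    obtain ⟨n, rfl⟩ := hπ i₀ i
    exact (hiter n).2
  refine eq_top_of_transvections fun i j => ?_
  obtain ⟨n, rfl⟩ := hπ i j
  induction n with
  | zero => exact fun h => absurd rfl h
  | succ n ih =>
    rw [pow_succ', Equiv.Perm.mul_apply]
    exact ih.trans (hone _)

/-- Bounding the first cohomology through a family of roots with distinct Galois twists. -/
theorem card_mul_finrank_groupCohomology_le [Nontrivial ι] (p : ℕ) [Fact p.Prime]
    [CharP K p] [CharP F p]
    (ρ : Representation F SLn M) (hinv : ∀ v, (∀ g, ρ g v = v) → v = 0) (π : Equiv.Perm ι)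
    (hπ : ∀ i j, ∃ n : ℕ, (π ^ n) i = j) (i₀ : ι) (hi₀ : i₀ ≠ π i₀)
    (hgen : Subring.closure (Set.range fun t : torus ι K =>
      ((t.1 i₀ * (t.1 (π i₀))⁻¹ : Kˣ) : K)) = ⊤) {κ : Type} [Fintype κ] (a b : κ → ι)
    (hab : ∀ k, a k ≠ b k)
    (hinj : ∀ k k' (σ σ' : K →+* F), rootChar σ (a k) (b k) = rootChar σ' (a k') (b k') →
      k = k' ∧ σ = σ') :
    Fintype.card κ * finrank F (groupCohomology (Rep.of ρ) 1) ≤ finrank F M := by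
  classical
  let _ : Fintype (torus ι K) := Fintype.ofFinite _
  have h1 := sum_finrank_weightSpace_le (card_torus_ne_zero (p := p)) ρ torusHom
    (fun x : κ × (K →+* F) => rootChar x.2 (a x.1) (b x.1)) (fun x y h => by
      obtain ⟨h2, h3⟩ := hinj _ _ _ _ h
      exact Prod.ext h2 h3)
  refine le_trans ?_ h1
  rw [Fintype.sum_prod_type]
  refine le_trans ?_ (Finset.card_nsmul_le_sum Finset.univ _
    (finrank F (groupCohomology (Rep.of ρ) 1)) fun k _ => ?_)
  · simp
  · refine (finrank_groupCohomology_le_sum_rootChar p ρ hinv π hπ i₀ hi₀ hgen).trans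
      (Finset.sum_le_sum fun σ _ => ?_)
    obtain ⟨π', hi, hj⟩ := exists_perm_apply_eq hi₀ (hab k)
    obtain ⟨g, ε, hg⟩ := exists_isMonomial (K := K) π'
    refine finrank_weightSpace_le_of_conj ρ torusHom g fun t =>
      ⟨torusPerm π' t, (hg.mul_torusHom fun i => rfl).symm, ?_⟩
    change σ _ = σ _
    simp only [torusPerm, hi, hj]

end SplitTorus

section FiniteFields

variable {K F : Type} [Field K] [Fintype K] [Field F]

/-- Two embeddings of a finite field have the same image. -/
theorem exists_apply_eq_of_ringHom (σ σ' : K →+* F) (x : K) : ∃ y, σ y = σ' x := by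
  classical
  have hq : 1 < Fintype.card K := Fintype.one_lt_card
  let P : Polynomial F := Polynomial.X ^ Fintype.card K - Polynomial.X
  have hP : P ≠ 0 := FiniteField.X_pow_card_sub_X_ne_zero F hq
  have hroot : ∀ (τ : K →+* F) y, τ y ∈ P.roots.toFinset := by
    intro τ y
    rw [Multiset.mem_toFinset, Polynomial.mem_roots hP]
    simp [P, Polynomial.IsRoot, ← map_pow, FiniteField.pow_card]
  have hsub : Finset.univ.image σ ⊆ P.roots.toFinset := by
    intro z hz
    obtain ⟨y, _, rfl⟩ := Finset.mem_image.1 hz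
    exact hroot σ y
  have hcard : P.roots.toFinset.card ≤ (Finset.univ.image σ).card := by
    rw [Finset.card_image_of_injective _ σ.injective, Finset.card_univ]
    refine (Multiset.toFinset_card_le _).trans ((Polynomial.card_roots' P).trans ?_)
    exact (FiniteField.X_pow_card_sub_X_natDegree_eq F hq).le
  have h := Finset.eq_of_subset_of_card_le hsub hcard ▸ hroot σ' x
  obtain ⟨y, _, hy⟩ := Finset.mem_image.1 h
  exact ⟨y, hy⟩

/-- Two embeddings of a finite field differ by a power of Frobenius. -/
theorem exists_frobenius_of_ringHom {p e : ℕ} [Fact p.Prime] [CharP K p]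
    (hK : Fintype.card K = p ^ e) (σ σ' : K →+* F) :
    ∃ k < e, ∀ x, σ' x = σ (x ^ p ^ k) := by
  choose f hf using exists_apply_eq_of_ringHom σ σ'
  let _ : Algebra (ZMod p) K := ZMod.algebra K p
  let τ : K →+* K :=
    { toFun := f
      map_one' := σ.injective (by rw [hf, map_one, map_one])
      map_mul' := fun x y => σ.injective (by rw [hf, map_mul, map_mul, hf, hf])
      map_zero' := σ.injective (by rw [hf, map_zero, map_zero])
      map_add' := fun x y => σ.injective (by rw [hf, map_add, map_add, hf, hf]) }
  have hcomm : ∀ r, τ (algebraMap (ZMod p) K r) = algebraMap (ZMod p) K r := fun r =>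
    congrFun (congrArg DFunLike.coe (Subsingleton.elim (τ.comp (algebraMap (ZMod p) K))
      (algebraMap (ZMod p) K))) r
  let τ' : K →ₐ[ZMod p] K := { τ with commutes' := hcomm }
  obtain ⟨n, hn⟩ := (FiniteField.bijective_frobeniusAlgHom_pow (ZMod p) K).2 τ'
  have he : finrank (ZMod p) K = e := by
    have h1 := Module.card_eq_pow_finrank (K := ZMod p) (V := K)
    rw [hK, ZMod.card] at h1
    exact (Nat.pow_right_injective (Fact.out : p.Prime).two_le h1).symm
  refine ⟨n, he ▸ n.2, fun x => ?_⟩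
  rw [← hf]
  congr 1
  have h1 := congrArg (fun g : K →ₐ[ZMod p] K => g x) hn
  simp only at h1
  rw [AlgHom.coe_pow, FiniteField.coe_frobeniusAlgHom, pow_iterate, ZMod.card] at h1
  exact h1.symm

/-- There are finitely many embeddings of a finite field. -/
theorem finite_ringHom {p : ℕ} [Fact p.Prime] [CharP K p] : Finite (K →+* F) := by
  by_cases h : Nonempty (K →+* F)
  · obtain ⟨σ⟩ := h
    refine Finite.of_injective (β := K → K)
      (fun σ' x => (exists_apply_eq_of_ringHom σ σ' x).choose) fun σ₁ σ₂ h => ?_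
    refine RingHom.ext fun x => ?_
    rw [← (exists_apply_eq_of_ringHom σ σ₁ x).choose_spec,
      ← (exists_apply_eq_of_ringHom σ σ₂ x).choose_spec]
    exact congrArg σ (congrFun h x)
  · rw [not_nonempty_iff] at h
    infer_instance

omit [Field F] in
theorem card_sub_one_dvd_of_pow_eq_one {n : ℕ} (h : ∀ a : Kˣ, a ^ n = 1) :
    Fintype.card K - 1 ∣ n := by
  obtain ⟨g, hg⟩ := IsCyclic.exists_generator (α := Kˣ)
  have h1 := orderOf_eq_card_of_forall_mem_zpowers hg
  rw [← Nat.card_eq_fintype_card, ← Nat.card_units, ← h1]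
  exact orderOf_dvd_of_pow_eq_one (h g)

end FiniteFields

theorem eq_of_dvd_two_mul_one_add_pow {p e k : ℕ} (hp : p.Prime) (hk : k < e)
    (h : p ^ e - 1 ∣ 2 * (1 + p ^ k)) :
    p ^ e = 2 ∨ p ^ e = 3 ∨ p ^ e = 4 ∨ p ^ e = 5 ∨ p ^ e = 9 := by
  obtain ⟨m, rfl⟩ : ∃ m, e = m + 1 := ⟨e - 1, by omega⟩
  have hpk : p ^ k ≤ p ^ m := Nat.pow_le_pow_right hp.pos (by omega)
  have hpm : 1 ≤ p ^ m := Nat.one_le_pow _ _ hp.pos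
  rw [pow_succ] at h ⊢
  rcases lt_trichotomy p 3 with h3 | rfl | h3
  · obtain rfl : p = 2 := le_antisymm (by omega) hp.two_le
    have hcop : Nat.Coprime (2 ^ m * 2 - 1) 2 := by
      rw [Nat.coprime_two_right, Nat.odd_iff]
      omega
    have h1 := Nat.le_of_dvd (by positivity) (hcop.dvd_of_dvd_mul_left h)
    have h2 : 2 ^ m ≤ 2 := by omega
    have h4 : m ≤ 1 := by
      by_contra hm
      have := Nat.pow_le_pow_right (n := 2) (by norm_num) (show 2 ≤ m by omega)
      omega
    interval_cases m <;> simp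
  · have h1 := Nat.le_of_dvd (by positivity) h
    have h2 : 3 ^ m ≤ 3 := by omega
    have h4 : m ≤ 1 := by
      by_contra hm
      have := Nat.pow_le_pow_right (n := 3) (by norm_num) (show 2 ≤ m by omega)
      omega
    interval_cases m <;> simp
  · have h1 := Nat.le_of_dvd (by positivity) h
    have h5 : 5 ≤ p := by
      by_contra h5
      obtain rfl : p = 4 := by omega
      exact absurd hp (by norm_num)
    obtain ⟨s, rfl⟩ : ∃ s, p = 5 + s := ⟨p - 5, by omega⟩
    obtain ⟨c, hc⟩ : ∃ c, (5 + s) ^ m = 1 + c := ⟨(5 + s) ^ m - 1, by omega⟩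
    rw [hc] at h1 hpk ⊢
    have h6 : (1 + c) * (5 + s) = 5 + s + 5 * c + c * s := by ring
    have h7 : c = 0 := by
      rw [h6] at h1
      have := Nat.zero_le (c * s)
      omega
    subst h7
    have : s = 0 := by omega
    subst this
    simp

section SplitCases

open Matrix

theorem exists_finRotate_pow_apply {d : ℕ} (hd : 2 ≤ d) (i j : Fin d) :
    ∃ n : ℕ, (finRotate d ^ n) i = j := by
  have h : ∀ k : Fin d, finRotate d k ≠ k := by
    intro k
    have : k ∈ (finRotate d).support := by rw [support_finRotate_of_le hd]; exact Finset.mem_univ k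
    exact Equiv.Perm.mem_support.1 this
  exact (isCycle_finRotate_of_le hd).exists_pow_eq (h i) (h j)

theorem finRotate_apply_ne {d : ℕ} (hd : 2 ≤ d) (i : Fin d) : i ≠ finRotate d i := by
  have : i ∈ (finRotate d).support := by rw [support_finRotate_of_le hd]; exact Finset.mem_univ i
  exact (Equiv.Perm.mem_support.1 this).symm

variable {K : Type} [Field K]

theorem closure_eq_top_of_units_subset {S : Set K} (h : ∀ a : Kˣ, (a : K) ∈ S) :
    Subring.closure S = ⊤ := by
  rw [eq_top_iff]
  intro x _
  by_cases hx : x = 0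
  · rw [hx]; exact Subring.zero_mem _
  · exact Subring.subset_closure (h (Units.mk0 x hx))

theorem closure_eq_top_of_squares_subset [Finite K] {S : Set K} (h : ∀ a : Kˣ, (a : K) ^ 2 ∈ S) :
    Subring.closure S = ⊤ := by
  have hsq : ∀ x : K, x ^ 2 ∈ Subring.closure S := by
    intro x
    by_cases hx : x = 0
    · rw [hx, zero_pow two_ne_zero]; exact Subring.zero_mem _
    · exact Subring.subset_closure (h (Units.mk0 x hx))
  rw [eq_top_iff]
  intro x _
  by_cases h2 : ringChar K = 2
  · obtain ⟨y, rfl⟩ := FiniteField.isSquare_of_char_two h2 x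
    rw [← pow_two]
    exact hsq y
  · have h2 : (2 : K) ≠ 0 := Ring.two_ne_zero h2
    have : x = ((x + 1) / 2) ^ 2 - ((x - 1) / 2) ^ 2 := by
      field_simp
      ring
    rw [this]
    exact Subring.sub_mem _ (hsq _) (hsq _)

variable {ι F : Type} [Fintype ι] [DecidableEq ι] [Field F]

theorem rootChar_corootElt_of_ne_left (σ : K →+* F) {s r i j : ι} (h : s ≠ r) (hi : i = s)
    (hj : j ≠ s ∧ j ≠ r) (a : Kˣ) : rootChar σ i j (corootElt h a) = σ a := by
  subst hi
  change σ ((_ * _⁻¹ : Kˣ) : K) = _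
  rw [corootElt_left, corootElt_of_ne h a hj.1 hj.2, inv_one, mul_one]

theorem rootChar_corootElt_of_ne_right (σ : K →+* F) {s r i j : ι} (h : s ≠ r) (hj : j = s)
    (hi : i ≠ s ∧ i ≠ r) (a : Kˣ) : rootChar σ i j (corootElt h a) = (σ a)⁻¹ := by
  subst hj
  change σ ((_ * _⁻¹ : Kˣ) : K) = _
  rw [corootElt_left, corootElt_of_ne h a hi.1 hi.2, one_mul, Units.val_inv_eq_inv_val, map_inv₀]

theorem rootChar_corootElt_of_ne (σ : K →+* F) {s r i j : ι} (h : s ≠ r)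
    (hi : i ≠ s ∧ i ≠ r) (hj : j ≠ s ∧ j ≠ r) (a : Kˣ) :
    rootChar σ i j (corootElt h a) = 1 := by
  change σ ((_ * _⁻¹ : Kˣ) : K) = _
  rw [corootElt_of_ne h a hj.1 hj.2, corootElt_of_ne h a hi.1 hi.2]
  simp

theorem rootChar_corootElt_of_right_ne (σ : K →+* F) {s r i j : ι} (h : s ≠ r)
    (hi : i ≠ s ∧ i ≠ r) (hj : j = r) (a : Kˣ) :
    rootChar σ i j (corootElt h a) = σ a := by
  subst hj
  change σ ((_ * _⁻¹ : Kˣ) : K) = _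
  rw [corootElt_right, corootElt_of_ne h a hi.1 hi.2]
  simp

theorem rootChar_corootElt_of_right_left (σ : K →+* F) {s r i j : ι} (h : s ≠ r)
    (hi : i = r) (hj : j ≠ s ∧ j ≠ r) (a : Kˣ) :
    rootChar σ i j (corootElt h a) = (σ a)⁻¹ := by
  subst hi
  change σ ((_ * _⁻¹ : Kˣ) : K) = _
  rw [corootElt_right, corootElt_of_ne h a hj.1 hj.2]
  simp

theorem rootChar_corootElt (σ : K →+* F) {s r : ι} (h : s ≠ r) (a : Kˣ) :
    rootChar σ s r (corootElt h a) = σ a ^ 2 := by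
  change σ ((_ * _⁻¹ : Kˣ) : K) = _
  rw [corootElt_right, corootElt_left, inv_inv, Units.val_mul, map_mul, pow_two]

theorem rootChar_corootElt_symm (σ : K →+* F) {s r : ι} (h : s ≠ r) (a : Kˣ) :
    rootChar σ r s (corootElt h a) = (σ a ^ 2)⁻¹ := by
  change σ ((_ * _⁻¹ : Kˣ) : K) = _
  rw [corootElt_right, corootElt_left, Units.val_mul, map_mul, pow_two, mul_inv,
    Units.val_inv_eq_inv_val, map_inv₀]

theorem ringHom_eq_of_units {σ σ' : K →+* F} (h : ∀ a : Kˣ, σ a = σ' a) : σ = σ' := by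
  refine RingHom.ext fun x => ?_
  by_cases hx : x = 0
  · rw [hx, map_zero, map_zero]
  · exact h (Units.mk0 x hx)

theorem eq_of_rootChar_eq {σ σ' : K →+* F} {i j r : ι} (hri : r ≠ i) (hrj : r ≠ j) (hij : i ≠ j)
    (h : rootChar σ i j = rootChar σ' i j) : σ = σ' := by
  refine ringHom_eq_of_units fun a => ?_
  have h1 := DFunLike.congr_fun h (corootElt hri.symm a)
  rwa [rootChar_corootElt_of_ne_left _ _ rfl ⟨hij.symm, hrj.symm⟩,
    rootChar_corootElt_of_ne_left _ _ rfl ⟨hij.symm, hrj.symm⟩] at h1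

theorem units_pow_eq_one_of_map {σ : K →+* F} {a : Kˣ} {n : ℕ} (h : σ a ^ n = 1) : a ^ n = 1 := by
  rw [← map_pow] at h
  refine Units.ext ?_
  rw [Units.val_pow_eq_pow_val, Units.val_one]
  exact σ.injective (h.trans (map_one σ).symm)

theorem units_eq_one_of_map {σ : K →+* F} {a : Kˣ} (h : σ a = 1) : a = 1 := by
  have := units_pow_eq_one_of_map (σ := σ) (a := a) (n := 1) (by rwa [pow_one])
  rwa [pow_one] at this

/-- Distinct roots with a fixed first index have distinct twists in large rank. -/
theorem units_eq_one_of_rootChar_eq {σ σ' : K →+* F} {i j k l r : ι}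
    (hri : r ≠ i) (hrj : r ≠ j) (hrk : r ≠ k) (hrl : r ≠ l) (hij : i ≠ j) (hik : i ≠ k)
    (hil : i ≠ l) (h : rootChar σ i j = rootChar σ' k l) (a : Kˣ) : a = 1 := by
  have h1 := DFunLike.congr_fun h (corootElt hri.symm a)
  rw [rootChar_corootElt_of_ne_left _ _ rfl ⟨hij.symm, hrj.symm⟩,
    rootChar_corootElt_of_ne _ _ ⟨hik.symm, hrk.symm⟩ ⟨hil.symm, hrl.symm⟩] at h1
  exact units_eq_one_of_map h1

theorem units_eq_one_of_rootChar_eq_left {σ σ' : K →+* F} {i j l r : ι}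
    (hri : r ≠ i) (hrj : r ≠ j) (hrl : r ≠ l) (hij : i ≠ j) (hjl : j ≠ l)
    (h : rootChar σ i j = rootChar σ' i l) (a : Kˣ) : a = 1 := by
  have h1 := DFunLike.congr_fun h (corootElt hrj.symm a)
  rw [rootChar_corootElt_of_ne_right _ _ rfl ⟨hij, hri.symm⟩,
    rootChar_corootElt_of_ne _ _ ⟨hij, hri.symm⟩ ⟨hjl.symm, hrl.symm⟩, inv_eq_one] at h1
  exact units_eq_one_of_map h1

theorem units_pow_three_of_rootChar_eq_left {σ σ' : K →+* F} {i j l : ι}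
    (hij : i ≠ j) (hil : i ≠ l) (hjl : j ≠ l)
    (h : rootChar σ i j = rootChar σ' i l) (a : Kˣ) : a ^ 3 = 1 := by
  have h1 := DFunLike.congr_fun h (corootElt hjl a)
  rw [rootChar_corootElt_of_ne_right _ _ rfl ⟨hij, hil⟩,
    rootChar_corootElt_of_right_ne _ _ ⟨hij, hil⟩ rfl] at h1
  have h2 := DFunLike.congr_fun h (corootElt hij a)
  rw [rootChar_corootElt, rootChar_corootElt_of_ne_left _ _ rfl ⟨hil.symm, hjl.symm⟩, ← h1] at h2
  refine units_pow_eq_one_of_map (σ := σ) ?_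
  rw [pow_succ, h2, inv_mul_cancel₀]
  exact fun h0 => a.ne_zero ((map_eq_zero σ).1 h0)

theorem units_pow_three_of_rootChar_eq_right {σ σ' : K →+* F} {i j l : ι}
    (hij : i ≠ j) (hil : i ≠ l) (hjl : j ≠ l)
    (h : rootChar σ i l = rootChar σ' j l) (a : Kˣ) : a ^ 3 = 1 := by
  have h1 := DFunLike.congr_fun h (corootElt hij a)
  rw [rootChar_corootElt_of_ne_left _ _ rfl ⟨hil.symm, hjl.symm⟩,
    rootChar_corootElt_of_right_left _ _ rfl ⟨hil.symm, hjl.symm⟩] at h1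
  have h2 := DFunLike.congr_fun h (corootElt hil a)
  rw [rootChar_corootElt, rootChar_corootElt_of_right_ne _ _ ⟨hij.symm, hjl⟩ rfl] at h2
  refine units_pow_eq_one_of_map (σ := σ) ?_
  rw [pow_succ, h2, h1, mul_inv_cancel₀]
  exact fun h0 => a.ne_zero ((map_eq_zero σ').1 h0)

theorem units_pow_three_of_rootChar_eq_path {σ σ' : K →+* F} {i j l : ι}
    (hij : i ≠ j) (hil : i ≠ l) (hjl : j ≠ l)
    (h : rootChar σ i j = rootChar σ' j l) (a : Kˣ) : a ^ 3 = 1 := by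
  have h1 := DFunLike.congr_fun h (corootElt hil a)
  rw [rootChar_corootElt_of_ne_left _ _ rfl ⟨hij.symm, hjl⟩,
    rootChar_corootElt_of_right_ne _ _ ⟨hij.symm, hjl⟩ rfl] at h1
  have h2 := DFunLike.congr_fun h (corootElt hij a)
  rw [rootChar_corootElt, rootChar_corootElt_of_right_left _ _ rfl ⟨hil.symm, hjl.symm⟩, ← h1] at h2
  refine units_pow_eq_one_of_map (σ := σ) ?_
  rw [pow_succ, h2, inv_mul_cancel₀]
  exact fun h0 => a.ne_zero ((map_eq_zero σ).1 h0)

theorem exists_fin_notMem {d : ℕ} (s : Finset (Fin d)) (h : s.card < d) : ∃ r, r ∉ s := by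
  by_contra! h'
  have : s = Finset.univ := Finset.eq_univ_iff_forall.2 h'
  rw [this, Finset.card_univ, Fintype.card_fin] at h
  exact lt_irrefl _ h

variable [Fintype K] [IsAlgClosed F] {M : Type} [AddCommGroup M] [Module F M] [FiniteDimensional F M]

theorem mul_finrank_le_of_three_le (p : ℕ) [Fact p.Prime] [CharP K p] [CharP F p]
    {d : ℕ} (hd : 3 ≤ d)
    (ρ : Representation F (Matrix.SpecialLinearGroup (Fin d) K) M)
    (hinv : ∀ v, (∀ g, ρ g v = v) → v = 0) {κ : Type} [Fintype κ] (a b : κ → Fin d)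
    (hab : ∀ k, a k ≠ b k)
    (hinj : ∀ k k' (σ σ' : K →+* F), rootChar σ (a k) (b k) = rootChar σ' (a k') (b k') →
      k = k') :
    Fintype.card κ * finrank F (groupCohomology (Rep.of ρ) 1) ≤ finrank F M := by
  have : Finite (K →+* F) := finite_ringHom (p := p)
  let _ : Fintype (K →+* F) := Fintype.ofFinite _
  have : Nontrivial (Fin d) := Fin.nontrivial_iff_two_le.2 (by omega)
  have hr : ∀ i j : Fin d, ∃ r, r ≠ i ∧ r ≠ j := by
    intro i j
    obtain ⟨r, hr⟩ := exists_fin_notMem {i, j} (lt_of_le_of_lt Finset.card_le_two (by omega))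
    simp only [Finset.mem_insert, Finset.mem_singleton, not_or] at hr
    exact ⟨r, hr⟩
  let i₀ : Fin d := ⟨0, by omega⟩
  have hi₀ := finRotate_apply_ne (by omega) i₀
  refine card_mul_finrank_groupCohomology_le p ρ hinv (finRotate d)
    (exists_finRotate_pow_apply (by omega)) i₀ hi₀ ?_ a b hab ?_
  · refine closure_eq_top_of_units_subset fun x => ?_
    obtain ⟨r, hr1, hr2⟩ := hr i₀ (finRotate d i₀)
    refine ⟨corootElt hr1.symm x, ?_⟩
    simp only [corootElt_left, corootElt_of_ne hr1.symm x hi₀.symm hr2.symm, inv_one, mul_one]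
  · intro k k' σ σ' h
    obtain rfl := hinj k k' σ σ' h
    obtain ⟨r, hr1, hr2⟩ := hr (a k) (b k)
    exact ⟨rfl, eq_of_rootChar_eq hr1 hr2 (hab k) h⟩

theorem three_mul_finrank_le (p : ℕ) [Fact p.Prime] [CharP K p] [CharP F p]
    (ρ : Representation F (Matrix.SpecialLinearGroup (Fin 3) K) M)
    (hinv : ∀ v, (∀ g, ρ g v = v) → v = 0) (hK : ∃ a : Kˣ, a ^ 3 ≠ 1) :
    3 * finrank F (groupCohomology (Rep.of ρ) 1) ≤ finrank F M := by
  obtain ⟨x, hx⟩ := hK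
  refine (mul_finrank_le_of_three_le p (d := 3) le_rfl ρ hinv (κ := Fin 3)
    ![0, 0, 1] ![1, 2, 2] (by decide) ?_)
  intro k k' σ σ' h
  fin_cases k <;> fin_cases k'
  · rfl
  · exact absurd (units_pow_three_of_rootChar_eq_left (by decide) (by decide) (by decide) h x) hx
  · exact absurd (units_pow_three_of_rootChar_eq_path (by decide) (by decide) (by decide) h x) hx
  · exact absurd (units_pow_three_of_rootChar_eq_left (by decide) (by decide) (by decide)
      h.symm x) hx
  · rfl
  · exact absurd (units_pow_three_of_rootChar_eq_right (by decide) (by decide) (by decide) h x) hx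
  · exact absurd (units_pow_three_of_rootChar_eq_path (by decide) (by decide) (by decide)
      h.symm x) hx
  · exact absurd (units_pow_three_of_rootChar_eq_right (by decide) (by decide) (by decide)
      h.symm x) hx
  · rfl

theorem mul_finrank_le_of_four_le (p : ℕ) [Fact p.Prime] [CharP K p] [CharP F p]
    {d : ℕ} (hd : 4 ≤ d)
    (ρ : Representation F (Matrix.SpecialLinearGroup (Fin d) K) M)
    (hinv : ∀ v, (∀ g, ρ g v = v) → v = 0) (hK : ∃ a : Kˣ, a ≠ 1) {l : ℕ} (hl : l ≤ d)
    (hld : l < d ∨ 5 ≤ d) :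
    l * finrank F (groupCohomology (Rep.of ρ) 1) ≤ finrank F M := by
  obtain ⟨x, hx⟩ := hK
  let i₀ : Fin d := ⟨0, by omega⟩
  let i₁ : Fin d := ⟨1, by omega⟩
  let i₂ : Fin d := ⟨2, by omega⟩
  let a : Fin l → Fin d := fun k => if k.1 + 1 < d then i₀ else i₁
  let b : Fin l → Fin d := fun k => if h : k.1 + 1 < d then ⟨k.1 + 1, h⟩ else i₂
  have key : ∀ k k' (σ σ' : K →+* F), k.1 < k'.1 →
      rootChar σ (a k) (b k) ≠ rootChar σ' (a k') (b k') := by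
    intro k k' σ σ' hkk h
    have hk : k.1 + 1 < d := by omega
    have hak : a k = i₀ := if_pos hk
    have hbk : b k = ⟨k.1 + 1, hk⟩ := dif_pos hk
    rw [hak, hbk] at h
    by_cases hk' : k'.1 + 1 < d
    · have hak' : a k' = i₀ := if_pos hk'
      have hbk' : b k' = ⟨k'.1 + 1, hk'⟩ := dif_pos hk'
      rw [hak', hbk'] at h
      obtain ⟨r, hr⟩ := exists_fin_notMem {i₀, ⟨k.1 + 1, hk⟩, ⟨k'.1 + 1, hk'⟩}
        (lt_of_le_of_lt Finset.card_le_three (by omega))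
      simp only [Finset.mem_insert, Finset.mem_singleton, not_or] at hr
      refine hx (units_eq_one_of_rootChar_eq_left hr.1 hr.2.1 hr.2.2 ?_ ?_ h x)
      all_goals
        rw [Ne, Fin.mk.injEq]
        omega
    · have hak' : a k' = i₁ := if_neg hk'
      have hbk' : b k' = i₂ := dif_neg hk'
      rw [hak', hbk'] at h
      obtain ⟨r, hr⟩ := exists_fin_notMem {i₀, ⟨k.1 + 1, hk⟩, i₁, i₂}
        (lt_of_le_of_lt Finset.card_le_four (by omega))
      simp only [Finset.mem_insert, Finset.mem_singleton, not_or] at hr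
      refine hx (units_eq_one_of_rootChar_eq hr.1 hr.2.1 hr.2.2.1 hr.2.2.2 ?_ ?_ ?_ h x)
      all_goals
        rw [Ne, Fin.mk.injEq]
        omega
  have h := mul_finrank_le_of_three_le p (by omega) ρ hinv a b ?_ ?_
  · rwa [Fintype.card_fin] at h
  · intro k
    by_cases hk : k.1 + 1 < d
    · have hak : a k = i₀ := if_pos hk
      have hbk : b k = ⟨k.1 + 1, hk⟩ := dif_pos hk
      rw [hak, hbk, Ne, Fin.mk.injEq]
      omega
    · have hak : a k = i₁ := if_neg hk
      have hbk : b k = i₂ := dif_neg hk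
      rw [hak, hbk, Ne, Fin.mk.injEq]
      omega
  · intro k k' σ σ' h
    rcases lt_trichotomy k.1 k'.1 with h1 | h1 | h1
    · exact absurd h (key k k' σ σ' h1)
    · exact Fin.ext h1
    · exact absurd h.symm (key k' k σ' σ h1)

theorem two_mul_finrank_le (p : ℕ) [Fact p.Prime] [CharP K p] [CharP F p]
    {e : ℕ} (hK : Fintype.card K = p ^ e)
    (ρ : Representation F (Matrix.SpecialLinearGroup (Fin 2) K) M)
    (hinv : ∀ v, (∀ g, ρ g v = v) → v = 0)
    (hq : ¬ (p ^ e = 2 ∨ p ^ e = 3 ∨ p ^ e = 4 ∨ p ^ e = 5 ∨ p ^ e = 9)) :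
    2 * finrank F (groupCohomology (Rep.of ρ) 1) ≤ finrank F M := by
  have : Finite (K →+* F) := finite_ringHom (p := p)
  let _ : Fintype (K →+* F) := Fintype.ofFinite _
  have h01 : (0 : Fin 2) ≠ 1 := by decide
  have hne : ∀ σ σ' : K →+* F, rootChar σ (0 : Fin 2) 1 ≠ rootChar σ' 1 0 := by
    intro σ σ' h
    obtain ⟨k, hk, hσ⟩ := exists_frobenius_of_ringHom hK σ σ'
    refine hq (eq_of_dvd_two_mul_one_add_pow Fact.out hk ?_)
    rw [← hK]
    refine card_sub_one_dvd_of_pow_eq_one fun a => ?_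
    have h1 := DFunLike.congr_fun h (corootElt h01 a)
    rw [rootChar_corootElt, rootChar_corootElt_symm, hσ] at h1
    have ha : σ a ≠ 0 := fun h0 => a.ne_zero ((map_eq_zero σ).1 h0)
    refine units_pow_eq_one_of_map (σ := σ) ?_
    rw [mul_comm, pow_mul, pow_add, pow_one, mul_pow, h1, map_pow, inv_mul_cancel₀]
    exact pow_ne_zero _ (pow_ne_zero _ ha)
  have hsame : ∀ (σ σ' : K →+* F) {i j : Fin 2} (hij : i ≠ j),
      rootChar σ i j = rootChar σ' i j → σ = σ' := by
    intro σ σ' i j hij h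
    refine RingHom.eq_of_eqOn_set_dense (s := {x : K | ∃ a : Kˣ, (a : K) ^ 2 = x})
      (closure_eq_top_of_squares_subset fun a => ⟨a, rfl⟩) ?_
    rintro _ ⟨a, rfl⟩
    have h1 := DFunLike.congr_fun h (corootElt hij a)
    rwa [rootChar_corootElt, rootChar_corootElt, ← map_pow, ← map_pow] at h1
  refine card_mul_finrank_groupCohomology_le p ρ hinv (finRotate 2)
    (exists_finRotate_pow_apply le_rfl) 0 (by decide) ?_ (κ := Fin 2) ![0, 1] ![1, 0]
    (by decide) ?_
  · refine closure_eq_top_of_squares_subset fun a => ⟨corootElt h01 a, ?_⟩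
    have h1 : finRotate 2 0 = 1 := by decide
    simp only [h1, corootElt_left, corootElt_right, inv_inv, Units.val_mul, pow_two]
  · intro k k' σ σ' h
    fin_cases k <;> fin_cases k'
    · exact ⟨rfl, hsame σ σ' h01 h⟩
    · exact absurd h (hne _ _)
    · exact absurd h.symm (hne _ _)
    · exact ⟨rfl, hsame σ σ' h01.symm h⟩

end SplitCases

section FrobeniusNormalized

variable {F G M A : Type} [Field F] [Group G] [AddCommGroup M] [Module F M] [CommGroup A]
  [Fintype A]

theorem weightProj_sq_eq_zero {ρ : Representation F G M} {θ : A →* G} {w : G}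
    (hw : ∀ a, w * θ a = θ (a ^ 2) * w) (hA : (Nat.card A).Coprime 2) {χ : A →* F} {v : M}
    (hv : ρ w v = v) (h : weightProj ρ θ χ v = 0) : weightProj ρ θ (χ ^ 2) v = 0 := by
  have h1 : ρ w (weightProj ρ θ (χ ^ 2) v) = 0 := by
    rw [← h, weightProj_apply, weightProj_apply, map_sum]
    refine Fintype.sum_equiv (powCoprime hA) _ _ fun a => ?_
    rw [map_smul, powCoprime_apply, ← inv_pow, map_pow, MonoidHom.pow_apply]
    congr 1
    rw [← Module.End.mul_apply, ← map_mul, hw, map_mul, Module.End.mul_apply, hv]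
  have h2 := congrArg (ρ w⁻¹) h1
  rwa [← Module.End.mul_apply, ← map_mul, inv_mul_cancel, map_one, map_zero] at h2

theorem weightProj_two_pow_eq_zero {ρ : Representation F G M} {θ : A →* G} {w : G}
    (hw : ∀ a, w * θ a = θ (a ^ 2) * w) (hA : (Nat.card A).Coprime 2) {χ : A →* F} {v : M}
    (hv : ρ w v = v) (h : weightProj ρ θ χ v = 0) (j : ℕ) :
    weightProj ρ θ (χ ^ 2 ^ j) v = 0 := by
  induction j with
  | zero => rwa [pow_zero, pow_one]
  | succ j ih => rw [pow_succ, pow_mul]; exact weightProj_sq_eq_zero hw hA hv ih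

omit [Fintype A] in
theorem finrank_weightSpace_le_two_pow [FiniteDimensional F M] {ρ : Representation F G M}
    {θ : A →* G} {w : G} (hw : ∀ a, w * θ a = θ (a ^ 2) * w) (χ : A →* F) (j : ℕ) :
    finrank F (weightSpace ρ θ χ) ≤ finrank F (weightSpace ρ θ (χ ^ 2 ^ j)) := by
  induction j with
  | zero => rw [pow_zero, pow_one]
  | succ j ih =>
    refine ih.trans (finrank_weightSpace_le_of_conj ρ θ w⁻¹ fun b => ⟨b ^ 2, ?_, ?_⟩)
    · rw [mul_inv_eq_iff_eq_mul, mul_assoc, ← hw, inv_mul_cancel_left]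
    · rw [map_pow, pow_succ 2 j, pow_mul, MonoidHom.pow_apply]

theorem cocycleSpace_fixed {ρ : Representation F G M} {c : G → M} (hc : c ∈ cocycleSpace ρ)
    {w x : G} (hcw : c w = 0) (hwx : w * x = x * w) : ρ w (c x) = c x := by
  have h1 := hc w x
  rw [hwx, hc x w, hcw, map_zero, zero_add, add_zero] at h1
  exact h1.symm

/-- A bound from a torus normalized by a Frobenius element and two Frobenius orbits of weights. -/
theorem mul_finrank_groupCohomology_le_of_frobenius [Finite G] [FiniteDimensional F M]
    (ρ : Representation F G M) (hinv : ∀ v, (∀ g, ρ g v = v) → v = 0)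
    (hAF : (Fintype.card A : F) ≠ 0) (hA : (Nat.card A).Coprime 2) {θ : A →* G} {w : G}
    (hw : ∀ a, w * θ a = θ (a ^ 2) * w) (χ : Bool → (A →* F)) (N : ℕ)
    (hχ : Function.Injective fun x : Fin N × Bool => χ x.2 ^ 2 ^ (x.1 : ℕ)) (x : Bool → G)
    (hx : ∀ b, w * x b = x b * w)
    (h : ∀ c ∈ cocycleSpace ρ, (∀ a, c (θ a) = 0) →
      (∀ b (j : ℕ), weightProj ρ θ (χ b ^ 2 ^ j) (c (x b)) = 0) → c = 0) :
    N * finrank F (groupCohomology (Rep.of ρ) 1) ≤ finrank F M := by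
  have h1 := finrank_groupCohomology_le_sum_weightSpace ρ hinv hAF θ w
    (fun a' => ⟨(powCoprime hA).symm a', by
      rw [hw, ← powCoprime_apply (h := hA), Equiv.apply_symm_apply]⟩) χ x
    (fun c hc hcA hcw h0 => h c hc hcA fun b j =>
      weightProj_two_pow_eq_zero hw hA (cocycleSpace_fixed hc hcw (hx b)) (h0 b) j)
  have h2 := sum_finrank_weightSpace_le hAF ρ θ _ hχ
  rw [Fintype.sum_prod_type] at h2
  refine le_trans ?_ h2
  refine le_trans ?_ (Finset.card_nsmul_le_sum Finset.univ _
    (finrank F (groupCohomology (Rep.of ρ) 1)) fun k _ => h1.trans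
      (Finset.sum_le_sum fun b _ => finrank_weightSpace_le_two_pow hw (χ b) k))
  simp

end FrobeniusNormalized

section BlockWeights

variable {F L₁ L₂ : Type} [Field F] [Field L₁] [Field L₂]

/-- The character `(s, t) ↦ σ₁ s / σ₂ t`. -/
def blockChar (σ₁ : L₁ →+* F) (σ₂ : L₂ →+* F) : L₁ˣ × L₂ˣ →* F where
  toFun x := σ₁ x.1 * σ₂ (x.2⁻¹ : L₂ˣ)
  map_one' := by simp
  map_mul' x y := by
    simp only [Prod.fst_mul, Prod.snd_mul, mul_inv, Units.val_mul, map_mul]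
    ring

theorem exists_blockChar_eq {V : Type} [AddCommGroup V] (β : L₁ →+ L₂ →+ V)
    (hβ : ∀ φ : V →+ F, (∀ y z, φ (β y z) = 0) → φ = 0) {φ : V →+ F} (hφ : φ ≠ 0)
    {ψ : L₁ˣ × L₂ˣ →* F}
    (h : ∀ (s : L₁ˣ) (t : L₂ˣ) y z, φ (β (s * y) ((t⁻¹ : L₂ˣ) * z)) = ψ (s, t) * φ (β y z)) :
    ∃ σ₁ σ₂, blockChar σ₁ σ₂ = ψ := by
  obtain ⟨y₀, z₀, h0⟩ : ∃ y z, φ (β y z) ≠ 0 := by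
    by_contra! h'
    exact hφ (hβ φ h')
  let φ₁ : L₁ →+ F := φ.comp (β.flip z₀)
  let φ₂ : L₂ →+ F := φ.comp (β y₀)
  have hφ₁ : φ₁ ≠ 0 := fun h' => h0 (DFunLike.congr_fun h' y₀)
  have hφ₂ : φ₂ ≠ 0 := fun h' => h0 (DFunLike.congr_fun h' z₀)
  have h1 : ∀ (s : L₁ˣ) y, φ₁ (s * y) = ψ (s, 1) * φ₁ y := by
    intro s y
    have := h s 1 y z₀
    rwa [inv_one, Units.val_one, one_mul] at this
  have h2 : ∀ (t : L₂ˣ) z, φ₂ ((t⁻¹ : L₂ˣ) * z) = ψ (1, t) * φ₂ z := by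
    intro t z
    have := h 1 t y₀ z
    rwa [Units.val_one, one_mul] at this
  obtain ⟨σ₁, hσ₁⟩ := exists_ringHom_of_weight hφ₁ (Set.range ((↑) : L₁ˣ → L₁))
    (closure_eq_top_of_units_subset fun a => ⟨a, rfl⟩) (by
      rintro _ ⟨s, rfl⟩
      exact ⟨_, h1 s⟩)
  obtain ⟨σ₂, hσ₂⟩ := exists_ringHom_of_weight hφ₂ (Set.range ((↑) : L₂ˣ → L₂))
    (closure_eq_top_of_units_subset fun a => ⟨a, rfl⟩) (by
      rintro _ ⟨s, rfl⟩
      refine ⟨ψ (1, s⁻¹), fun z => ?_⟩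
      have := h2 s⁻¹ z
      rwa [inv_inv] at this)
  refine ⟨σ₁, σ₂, MonoidHom.ext ?_⟩
  rintro ⟨s, t⟩
  have hst : ((s, t) : L₁ˣ × L₂ˣ) = (s, 1) * (1, t) := by simp
  rw [hst, map_mul ψ]
  have h3 : σ₁ s = ψ (s, 1) := mul_right_cancel₀ h0 ((hσ₁ _ y₀).symm.trans (h1 s y₀))
  have h4 : σ₂ (t⁻¹ : L₂ˣ) = ψ (1, t) := mul_right_cancel₀ h0 ((hσ₂ _ z₀).symm.trans (h2 t z₀))
  rw [← h3, ← h4]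
  simp [blockChar]

variable [Fintype L₁] [Fintype L₂] [CharP L₁ 2] [CharP L₂ 2]

theorem pow_two_pow_mod {L : Type} [Field L] [Fintype L] {a : ℕ} (hL : Fintype.card L = 2 ^ a)
    (j : ℕ) (x : L) : x ^ 2 ^ j = x ^ 2 ^ (j % a) := by
  conv_lhs => rw [← Nat.mod_add_div j a, pow_add, mul_comm, pow_mul]
  congr 1
  rw [pow_mul, ← hL]
  exact FiniteField.pow_card_pow _ x

/-- Coprime Frobenius orbits can be synchronized. -/
theorem exists_blockChar_pow_eq {a b : ℕ} (h₁ : Fintype.card L₁ = 2 ^ a)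
    (h₂ : Fintype.card L₂ = 2 ^ b) (hab : a.Coprime b) (σ₁ τ₁ : L₁ →+* F) (σ₂ τ₂ : L₂ →+* F) :
    ∃ j : ℕ, blockChar σ₁ σ₂ ^ 2 ^ j = blockChar τ₁ τ₂ := by
  obtain ⟨k, hk, hτ₁⟩ := exists_frobenius_of_ringHom h₁ σ₁ τ₁
  obtain ⟨l, hl, hτ₂⟩ := exists_frobenius_of_ringHom h₂ σ₂ τ₂
  obtain ⟨j, hj1, hj2⟩ := Nat.chineseRemainder hab k l
  refine ⟨j, MonoidHom.ext fun x => ?_⟩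
  rw [MonoidHom.pow_apply]
  change (σ₁ _ * σ₂ _) ^ _ = τ₁ _ * τ₂ _
  rw [mul_pow, hτ₁, hτ₂, ← map_pow, ← map_pow, pow_two_pow_mod h₁ j, pow_two_pow_mod h₂ j, hj1, hj2,
    Nat.mod_eq_of_lt hk, Nat.mod_eq_of_lt hl]

theorem modEq_of_pow_eq {L : Type} [Field L] [Fintype L] [CharP L 2] {a i j : ℕ}
    (hL : Fintype.card L = 2 ^ a) (h : ∀ x : L, x ^ 2 ^ i = x ^ 2 ^ j) : i ≡ j [MOD a] := by
  let _ : Algebra (ZMod 2) L := ZMod.algebra L 2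
  have he : finrank (ZMod 2) L = a := by
    have h1 := Module.card_eq_pow_finrank (K := ZMod 2) (V := L)
    rw [hL, ZMod.card] at h1
    exact (Nat.pow_right_injective le_rfl h1).symm
  rw [← he, ← FiniteField.orderOf_frobeniusAlgHom (ZMod 2) L]
  have hp : 0 < orderOf (FiniteField.frobeniusAlgHom (ZMod 2) L) := by
    rw [FiniteField.orderOf_frobeniusAlgHom]; exact Module.finrank_pos
  rw [← (orderOf_pos_iff.1 hp).pow_eq_pow_iff_modEq]
  refine AlgHom.ext fun x => ?_
  simpa only [AlgHom.coe_pow, FiniteField.coe_frobeniusAlgHom, pow_iterate, ZMod.card] using h x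

end BlockWeights

section BlockModel

open Matrix

variable {K : Type} [Field K] {m n : Type} [Fintype m] [DecidableEq m]
  [Fintype n] [DecidableEq n]

theorem eq_one_of_card_eq_two [Fintype K] (hK : Fintype.card K = 2) {x : K} (hx : x ≠ 0) : x = 1 := by
  have := FiniteField.pow_card_sub_one_eq_one x hx
  rwa [hK, pow_one] at this

/-- Over the field with two elements, automorphisms are special. -/
noncomputable def autMatrix [Fintype K] (hK : Fintype.card K = 2) {V : Type} [AddCommGroup V] [Module K V]
    (B : Basis m K V) : (V ≃ₗ[K] V) →* Matrix.SpecialLinearGroup m K where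
  toFun f := ⟨LinearMap.toMatrix B B f, eq_one_of_card_eq_two hK (LinearEquiv.isUnit_det f B B).ne_zero⟩
  map_one' := specialLinearGroup_ext (LinearMap.toMatrix_one B)
  map_mul' f g := specialLinearGroup_ext (LinearMap.toMatrix_mul B (f : V →ₗ[K] V) g)

theorem autMatrix_mulVec [Fintype K] (hK : Fintype.card K = 2) {V : Type} [AddCommGroup V] [Module K V]
    (B : Basis m K V) (f : V ≃ₗ[K] V) (y : V) :
    (autMatrix hK B f).1 *ᵥ (B.equivFun y) = B.equivFun (f y) :=
  LinearMap.toMatrix_mulVec_repr B B f y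

/-- The block diagonal embedding. -/
def blockHom : Matrix.SpecialLinearGroup m K × Matrix.SpecialLinearGroup n K →*
    Matrix.SpecialLinearGroup (m ⊕ n) K where
  toFun x := ⟨fromBlocks x.1.1 0 0 x.2.1, by
    rw [det_fromBlocks_zero₂₁, x.1.2, x.2.2, one_mul]⟩
  map_one' := specialLinearGroup_ext fromBlocks_one
  map_mul' x y := specialLinearGroup_ext (by
    change fromBlocks (x.1.1 * y.1.1) 0 0 (x.2.1 * y.2.1) =
      fromBlocks x.1.1 0 0 x.2.1 * fromBlocks y.1.1 0 0 y.2.1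
    simp [fromBlocks_multiply])

/-- The upper unipotent block. -/
def upperBlock (X : Matrix m n K) : Matrix.SpecialLinearGroup (m ⊕ n) K :=
  ⟨fromBlocks 1 X 0 1, by simp⟩

/-- The lower unipotent block. -/
def lowerBlock (X : Matrix n m K) : Matrix.SpecialLinearGroup (m ⊕ n) K :=
  ⟨fromBlocks 1 0 X 1, by simp⟩

theorem upperBlock_add (X Y : Matrix m n K) : upperBlock (X + Y) = upperBlock X * upperBlock Y :=
  specialLinearGroup_ext (by
    change fromBlocks 1 (X + Y) 0 1 = fromBlocks 1 X 0 1 * fromBlocks 1 Y 0 1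
    simp [fromBlocks_multiply, add_comm])

theorem lowerBlock_add (X Y : Matrix n m K) : lowerBlock (X + Y) = lowerBlock X * lowerBlock Y :=
  specialLinearGroup_ext (by
    change fromBlocks 1 0 (X + Y) 1 = fromBlocks 1 0 X 1 * fromBlocks 1 0 Y 1
    simp [fromBlocks_multiply])

theorem blockHom_mul_upperBlock {g : Matrix.SpecialLinearGroup m K}
    {h : Matrix.SpecialLinearGroup n K} {X X' : Matrix m n K} (hX : g.1 * X = X' * h.1) :
    blockHom (g, h) * upperBlock X = upperBlock X' * blockHom (g, h) :=
  specialLinearGroup_ext (by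
    change fromBlocks g.1 0 0 h.1 * fromBlocks 1 X 0 1 = fromBlocks 1 X' 0 1 * fromBlocks g.1 0 0 h.1
    simp [fromBlocks_multiply, hX])

theorem blockHom_mul_lowerBlock {g : Matrix.SpecialLinearGroup m K}
    {h : Matrix.SpecialLinearGroup n K} {X X' : Matrix n m K} (hX : h.1 * X = X' * g.1) :
    blockHom (g, h) * lowerBlock X = lowerBlock X' * blockHom (g, h) :=
  specialLinearGroup_ext (by
    change fromBlocks g.1 0 0 h.1 * fromBlocks 1 0 X 1 = fromBlocks 1 0 X' 1 * fromBlocks g.1 0 0 h.1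
    simp [fromBlocks_multiply, hX])

theorem closure_blocks_eq_top [Nonempty m] [Nonempty n] :
    Subgroup.closure (Set.range (upperBlock (K := K) (m := m) (n := n)) ∪ Set.range lowerBlock) = ⊤ := by
  have hu : ∀ i j, RootJoined (Subgroup.closure (Set.range
      (upperBlock (K := K) (m := m) (n := n)) ∪ Set.range lowerBlock)) (Sum.inl i) (Sum.inr j) := by
    intro i j h x
    refine Subgroup.subset_closure (Or.inl ⟨single i j x, ?_⟩)
    refine specialLinearGroup_ext ?_
    rw [SpecialLinearGroup.transvection_coe]
    ext (a | a) (b | b) <;> simp [upperBlock, single, Matrix.one_apply]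
  have hl : ∀ i j, RootJoined (Subgroup.closure (Set.range
      (upperBlock (K := K) (m := m) (n := n)) ∪ Set.range lowerBlock)) (Sum.inr j) (Sum.inl i) := by
    intro i j h x
    refine Subgroup.subset_closure (Or.inr ⟨single j i x, ?_⟩)
    refine specialLinearGroup_ext ?_
    rw [SpecialLinearGroup.transvection_coe]
    ext (a | a) (b | b) <;> simp [lowerBlock, single, Matrix.one_apply]
  have : Nontrivial (m ⊕ n) := ⟨Sum.inl (Classical.arbitrary m), Sum.inr (Classical.arbitrary n), Sum.inl_ne_inr⟩
  refine eq_top_of_transvections ?_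
  rintro (i | i) (j | j)
  · exact (hu i (Classical.arbitrary n)).trans (hl j _)
  · exact hu i j
  · exact hl j i
  · exact (hl (Classical.arbitrary m) i).trans (hu _ j)

end BlockModel

section RankOne

open Matrix

variable {K : Type} [Field K] {m n : Type} [Fintype m] [DecidableEq m]
  [Fintype n] [DecidableEq n] {L₁ L₂ : Type} [Field L₁] [Field L₂] [Algebra K L₁] [Algebra K L₂]
  (B₁ : Basis m K L₁) (B₂ : Basis n K L₂)

variable [FiniteDimensional K L₂] [Algebra.IsSeparable K L₂]

/-- The rank one matrices attached to pairs of field elements. -/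
noncomputable def rankOne : L₁ →+ L₂ →+ Matrix m n K where
  toFun y :=
    { toFun := fun z => vecMulVec (B₁.equivFun y) (B₂.traceDual.equivFun z)
      map_zero' := by rw [map_zero]; ext; simp [vecMulVec_apply]
      map_add' := fun z z' => by rw [map_add, vecMulVec_add] }
  map_zero' := by
    ext z : 1
    change vecMulVec (B₁.equivFun 0) (B₂.traceDual.equivFun z) = 0
    rw [map_zero]; ext; simp [vecMulVec_apply]
  map_add' y y' := by
    ext z : 1
    change vecMulVec (B₁.equivFun (y + y')) (B₂.traceDual.equivFun z) =
      vecMulVec (B₁.equivFun y) (B₂.traceDual.equivFun z) +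
        vecMulVec (B₁.equivFun y') (B₂.traceDual.equivFun z)
    rw [map_add, add_vecMulVec]

omit [DecidableEq m] in
theorem rankOne_apply (y : L₁) (z : L₂) :
    rankOne B₁ B₂ y z = vecMulVec (B₁.equivFun y) (B₂.traceDual.equivFun z) := rfl

theorem equivFun_traceDual_vecMul {f' : L₂ → L₂} (g : L₂ →ₗ[K] L₂)
    (h : ∀ z x, Algebra.trace K L₂ (z * g x) = Algebra.trace K L₂ (f' z * x)) (z : L₂) :
    B₂.traceDual.equivFun z ᵥ* LinearMap.toMatrix B₂ B₂ g = B₂.traceDual.equivFun (f' z) := by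
  ext i
  simp only [vecMul, dotProduct, Basis.equivFun_apply, Basis.traceDual_repr_apply,
    LinearMap.toMatrix_apply, Algebra.traceForm_apply]
  rw [← h z]
  conv_rhs => rw [← B₂.sum_repr (g (B₂ i)), Finset.mul_sum, map_sum]
  refine Finset.sum_congr rfl fun j _ => ?_
  rw [mul_smul_comm, map_smul, smul_eq_mul, mul_comm]

theorem addSubgroup_closure_eq_top_of_rankOne {C : AddSubgroup (Matrix m n K)}
    (hC : ∀ y z, y ≠ 0 → z ≠ 0 → rankOne B₁ B₂ y z ∈ C) : C = ⊤ := by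
  rw [eq_top_iff]
  intro X _
  rw [matrix_eq_sum_single X]
  refine sum_mem fun i _ => sum_mem fun j _ => ?_
  have h1 : single i j (X i j) = rankOne B₁ B₂ (B₁.equivFun.symm (Pi.single i (X i j)))
      (B₂.traceDual.equivFun.symm (Pi.single j 1)) := by
    rw [rankOne_apply, LinearEquiv.apply_symm_apply, LinearEquiv.apply_symm_apply]
    ext k l
    simp only [single_apply, vecMulVec_apply, Pi.single_apply]
    by_cases hk : i = k
    · subst hk
      by_cases hl : j = l
      · subst hl; simp
      · simp [hl, Ne.symm hl]
    · simp [hk, Ne.symm hk]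
  rw [h1]
  set y := B₁.equivFun.symm (Pi.single i (X i j))
  set z := B₂.traceDual.equivFun.symm (Pi.single j 1)
  rcases eq_or_ne y 0 with h | h
  · rw [h, map_zero, AddMonoidHom.zero_apply]; exact C.zero_mem
  rcases eq_or_ne z 0 with h' | h'
  · rw [h', map_zero]; exact C.zero_mem
  exact hC _ _ h h'

end RankOne

section TorusBlocks

open Matrix

variable {K : Type} [Field K] [Fintype K] {m n : Type} [Fintype m] [DecidableEq m]
  [Fintype n] [DecidableEq n] {L₁ L₂ : Type} [Field L₁] [Field L₂] [Algebra K L₁] [Algebra K L₂]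
  (hK : Fintype.card K = 2) (B₁ : Basis m K L₁) (B₂ : Basis n K L₂)

/-- The torus of a block decomposition into field extensions. -/
noncomputable def blockTorus : L₁ˣ × L₂ˣ →* Matrix.SpecialLinearGroup (m ⊕ n) K :=
  blockHom.comp (((autMatrix hK B₁).comp (DistribMulAction.toModuleAut K L₁)).prodMap
    ((autMatrix hK B₂).comp (DistribMulAction.toModuleAut K L₂)))

variable [Finite L₁] [Finite L₂]

/-- The Frobenius element of a block decomposition into field extensions. -/
noncomputable def blockFrob : Matrix.SpecialLinearGroup (m ⊕ n) K :=
  blockHom (autMatrix hK B₁ (FiniteField.frobeniusAlgEquivOfAlgebraic K L₁).toLinearEquiv,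
    autMatrix hK B₂ (FiniteField.frobeniusAlgEquivOfAlgebraic K L₂).toLinearEquiv)

theorem frob_mul_smul {L : Type} [Field L] [Algebra K L] [Finite L] (s : Lˣ) :
    (FiniteField.frobeniusAlgEquivOfAlgebraic K L).toLinearEquiv *
      DistribMulAction.toModuleAut K L s =
    DistribMulAction.toModuleAut K L (s ^ Fintype.card K) *
      (FiniteField.frobeniusAlgEquivOfAlgebraic K L).toLinearEquiv := by
  refine LinearEquiv.ext fun x => ?_
  change FiniteField.frobeniusAlgEquivOfAlgebraic K L (s • x) =
    (s ^ Fintype.card K) • FiniteField.frobeniusAlgEquivOfAlgebraic K L x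
  simp [Units.smul_def, mul_pow]

theorem autMatrix_frob_mul_smul {L : Type} [Field L] [Algebra K L] [Finite L] (B : Basis m K L)
    (s : Lˣ) :
    autMatrix hK B (FiniteField.frobeniusAlgEquivOfAlgebraic K L).toLinearEquiv *
      autMatrix hK B (DistribMulAction.toModuleAut K L s) =
    autMatrix hK B (DistribMulAction.toModuleAut K L (s ^ 2)) *
      autMatrix hK B (FiniteField.frobeniusAlgEquivOfAlgebraic K L).toLinearEquiv := by
  rw [← map_mul, ← map_mul, frob_mul_smul, hK]

theorem blockFrob_mul_blockTorus (x : L₁ˣ × L₂ˣ) :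
    blockFrob hK B₁ B₂ * blockTorus hK B₁ B₂ x =
      blockTorus hK B₁ B₂ (x ^ 2) * blockFrob hK B₁ B₂ := by
  obtain ⟨s, t⟩ := x
  refine (map_mul blockHom _ _).symm.trans ((congrArg blockHom ?_).trans (map_mul blockHom _ _))
  exact Prod.ext (autMatrix_frob_mul_smul hK B₁ s) (autMatrix_frob_mul_smul hK B₂ t)

variable [FiniteDimensional K L₂] [Algebra.IsSeparable K L₂]

omit [Finite L₁] [Finite L₂] in
theorem autMatrix_mul_rankOne (f : L₁ ≃ₗ[K] L₁) (y : L₁) (z : L₂) :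
    (autMatrix hK B₁ f).1 * rankOne B₁ B₂ y z = rankOne B₁ B₂ (f y) z := by
  rw [rankOne_apply, mul_vecMulVec, autMatrix_mulVec, rankOne_apply]

omit [Finite L₁] [Finite L₂] [DecidableEq m] in
theorem rankOne_mul_smul (t : L₂ˣ) (y : L₁) (z : L₂) :
    rankOne B₁ B₂ y z * (autMatrix hK B₂ (DistribMulAction.toModuleAut K L₂ t)).1 =
      rankOne B₁ B₂ y (t * z) := by
  rw [rankOne_apply, vecMulVec_mul, rankOne_apply]
  congr 1
  refine equivFun_traceDual_vecMul B₂ (f' := fun z => t * z) _ (fun z x => ?_) z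
  change Algebra.trace K L₂ (z * (t * x)) = _
  ring_nf

omit [Finite L₁] [DecidableEq m] in
theorem rankOne_one_mul_frob (y : L₁) :
    rankOne B₁ B₂ y 1 * (autMatrix hK B₂
      (FiniteField.frobeniusAlgEquivOfAlgebraic K L₂).toLinearEquiv).1 = rankOne B₁ B₂ y 1 := by
  rw [rankOne_apply, vecMulVec_mul]
  congr 1
  refine equivFun_traceDual_vecMul B₂
    (f' := (FiniteField.frobeniusAlgEquivOfAlgebraic K L₂).symm) _ (fun z x => ?_) 1 |>.trans ?_
  · change Algebra.trace K L₂ (z * FiniteField.frobeniusAlgEquivOfAlgebraic K L₂ x) = _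
    rw [← Algebra.trace_eq_of_algEquiv (FiniteField.frobeniusAlgEquivOfAlgebraic K L₂)
      ((FiniteField.frobeniusAlgEquivOfAlgebraic K L₂).symm z * x), map_mul (FiniteField.frobeniusAlgEquivOfAlgebraic K L₂),
      AlgEquiv.apply_symm_apply]
  · rw [map_one]

end TorusBlocks

section BlockCocycle

open Matrix

theorem weightProj_comp_equiv {F G M A B : Type} [Field F] [Group G] [AddCommGroup M] [Module F M]
    [CommGroup A] [Fintype A] [CommGroup B] [Fintype B] (ρ : Representation F G M) (θ : B →* G)
    (χ : B →* F) (e : A ≃* B) (v : M) :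
    weightProj ρ (θ.comp e.toMonoidHom) (χ.comp e.toMonoidHom) v = weightProj ρ θ χ v := by
  rw [weightProj_apply, weightProj_apply]
  refine Fintype.sum_equiv e.toEquiv _ _ fun a => ?_
  change χ (e a⁻¹) • _ = χ (e a)⁻¹ • _
  rw [map_inv]
  rfl

variable {K : Type} [Field K] [Fintype K] {m n : Type} [Fintype m] [DecidableEq m]
  [Fintype n] [DecidableEq n] {L₁ L₂ : Type} [Field L₁] [Field L₂] [Algebra K L₁] [Algebra K L₂]
  (hK : Fintype.card K = 2) (B₁ : Basis m K L₁) (B₂ : Basis n K L₂)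
  [Fintype L₁] [Fintype L₂] [CharP L₁ 2] [CharP L₂ 2] [FiniteDimensional K L₂]
  [Algebra.IsSeparable K L₂] [Fintype L₁ˣ] [Fintype L₂ˣ]
  {F G M : Type} [Field F] [IsAlgClosed F] [CharP F 2] [Group G] [AddCommGroup M] [Module F M]
  [FiniteDimensional F M]

theorem cocycleSpace_eq_zero_of_block [CharP K 2] {a b : ℕ} (h₁ : Fintype.card L₁ = 2 ^ a)
    (h₂ : Fintype.card L₂ = 2 ^ b) (hab : a.Coprime b)
    (hA : (Fintype.card (L₁ˣ × L₂ˣ) : F) ≠ 0) {ρ : Representation F G M}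
    {θ : L₁ˣ × L₂ˣ →* G} (υ : Matrix m n K → G) (hadd : ∀ X Y, υ (X + Y) = υ X * υ Y)
    (hα : ∀ s t X, θ (s, t) * υ X = υ ((autMatrix hK B₁ (DistribMulAction.toModuleAut K L₁ s)).1 * X *
      (autMatrix hK B₂ (DistribMulAction.toModuleAut K L₂ t⁻¹)).1) * θ (s, t))
    (σ₁ : L₁ →+* F) (σ₂ : L₂ →+* F) {c : G → M} (hc : c ∈ cocycleSpace ρ)
    (hcA : ∀ a, c (θ a) = 0)
    (h0 : ∀ j : ℕ, weightProj ρ θ (blockChar σ₁ σ₂ ^ 2 ^ j) (c (υ (rankOne B₁ B₂ 1 1))) = 0) (X) :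
    c (υ X) = 0 := by
  have hυ0 : υ 0 = 1 := by
    have := hadd 0 0
    rwa [add_zero, left_eq_mul] at this
  have hrank : ∀ (s : L₁ˣ) (t : L₂ˣ) y z,
      (autMatrix hK B₁ (DistribMulAction.toModuleAut K L₁ s)).1 * rankOne B₁ B₂ y z *
      (autMatrix hK B₂ (DistribMulAction.toModuleAut K L₂ t⁻¹)).1 =
      rankOne B₁ B₂ (s * y) ((t⁻¹ : L₂ˣ) * z) := by
    intro s t y z
    rw [autMatrix_mul_rankOne, rankOne_mul_smul]
    rfl
  have : Fact (Nat.Prime 2) := ⟨Nat.prime_two⟩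
  refine cocycleSpace_eq_zero_of_weightProj (p := 2) hA υ hadd (fun X => ?_)
    (fun a X => (autMatrix hK B₁ (DistribMulAction.toModuleAut K L₁ a.1)).1 * X *
      (autMatrix hK B₂ (DistribMulAction.toModuleAut K L₂ a.2⁻¹)).1)
    (fun a X => hα a.1 a.2 X) (rankOne B₁ B₂ 1 1) ?_ (fun j : ℕ => blockChar σ₁ σ₂ ^ 2 ^ j)
    ?_ hc hcA h0 X
  · rw [sq, ← hadd, ← two_nsmul, ← Nat.cast_smul_eq_nsmul K, CharP.cast_eq_zero, zero_smul, hυ0]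
  · refine addSubgroup_closure_eq_top_of_rankOne B₁ B₂ fun y z hy hz =>
      AddSubgroup.subset_closure ⟨(Units.mk0 y hy, (Units.mk0 z hz)⁻¹), ?_⟩
    change _ * _ * _ = _
    rw [hrank]
    simp
  · rintro ψ ⟨φ, hφ, h⟩
    obtain ⟨τ₁, τ₂, rfl⟩ := exists_blockChar_eq (rankOne B₁ B₂) (φ := φ) (fun φ h0 => by
      have h1 := addSubgroup_closure_eq_top_of_rankOne B₁ B₂ (C := φ.ker) fun y z _ _ => h0 y z
      exact (AddMonoidHom.ker_eq_top_iff).1 h1) hφ (ψ := ψ) (fun s t y z => by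
        rw [← hrank]; exact h (s, t) _)
    exact exists_blockChar_pow_eq h₁ h₂ hab σ₁ τ₁ σ₂ τ₂

end BlockCocycle

theorem Nat.not_two_pow_sub_one_dvd {b i j : ℕ} (hb : 3 ≤ b) : ¬ 2 ^ b - 1 ∣ 2 ^ i + 2 ^ j := by
  intro h
  wlog hij : i ≤ j generalizing i j
  · exact this (by rwa [add_comm]) (by omega)
  obtain ⟨k, rfl⟩ := Nat.exists_eq_add_of_le hij
  have h8 : 2 ^ 3 ≤ 2 ^ b := Nat.pow_le_pow_right (by norm_num) hb
  have he : 2 ∣ 2 ^ b := dvd_pow_self 2 (by omega)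
  rw [pow_add, ← mul_one_add] at h
  have hcop : Nat.Coprime (2 ^ b - 1) (2 ^ i) := by
    refine Nat.Coprime.pow_right i ?_
    rw [Nat.coprime_two_right, Nat.odd_iff]
    omega
  have h1 := hcop.dvd_of_dvd_mul_left h
  have h2 : 2 ^ b ≡ 1 [MOD 2 ^ b - 1] := ((Nat.modEq_iff_dvd' (by omega)).2 dvd_rfl).symm
  have h3 : 1 + 2 ^ k ≡ 1 + 2 ^ (k % b) [MOD 2 ^ b - 1] := by
    refine Nat.ModEq.add_left 1 ?_
    conv_lhs => rw [← Nat.mod_add_div k b, pow_add, pow_mul]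
    simpa using (Nat.ModEq.refl _).mul (h2.pow (k / b))
  have h4 := (h3.dvd_iff dvd_rfl).1 h1
  have := eq_of_dvd_two_mul_one_add_pow Nat.prime_two (Nat.mod_lt k (by omega : 0 < b))
    (h4.mul_left 2)
  omega

section BlockBound

variable {F L₁ L₂ : Type} [Field F] [Field L₁] [Field L₂] [Fintype L₁] [Fintype L₂]
  [CharP L₁ 2] [CharP L₂ 2]

theorem pow_two_pow_modEq_of_units {L : Type} [Field L] [Fintype L] [CharP L 2] {a i j : ℕ}
    (hL : Fintype.card L = 2 ^ a) (σ : L →+* F)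
    (h : ∀ x : Lˣ, σ x ^ 2 ^ i = σ x ^ 2 ^ j) : i ≡ j [MOD a] := by
  refine modEq_of_pow_eq hL fun x => ?_
  rcases eq_or_ne x 0 with rfl | hx
  · simp
  · have := h (Units.mk0 x hx)
    rw [← map_pow, ← map_pow] at this
    exact σ.injective this

theorem modEq_of_blockChar_pow_eq {a b i j : ℕ} (h₁ : Fintype.card L₁ = 2 ^ a)
    (h₂ : Fintype.card L₂ = 2 ^ b) (hab : a.Coprime b) {σ₁ : L₁ →+* F} {σ₂ : L₂ →+* F}
    (h : blockChar σ₁ σ₂ ^ 2 ^ i = blockChar σ₁ σ₂ ^ 2 ^ j) : i ≡ j [MOD a * b] := by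
  rw [← Nat.modEq_and_modEq_iff_modEq_mul hab]
  constructor
  · refine pow_two_pow_modEq_of_units h₁ σ₁ fun x => ?_
    simpa [blockChar] using DFunLike.congr_fun h (x, 1)
  · refine pow_two_pow_modEq_of_units h₂ σ₂ fun x => ?_
    simpa [blockChar] using DFunLike.congr_fun h (1, x⁻¹)

omit [Fintype L₁] [CharP L₁ 2] [CharP L₂ 2] in
theorem blockChar_pow_ne_swap {b i j : ℕ}
    (h₂ : Fintype.card L₂ = 2 ^ b) (hb : 3 ≤ b) {σ₁ : L₁ →+* F} {σ₂ : L₂ →+* F} :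
    blockChar σ₁ σ₂ ^ 2 ^ i ≠
      ((blockChar σ₂ σ₁).comp (MulEquiv.prodComm (M := L₁ˣ) (N := L₂ˣ)).toMonoidHom) ^ 2 ^ j := by
  intro h
  refine Nat.not_two_pow_sub_one_dvd hb (i := i) (j := j) ?_
  rw [← h₂]
  refine card_sub_one_dvd_of_pow_eq_one fun t => ?_
  have h1 := DFunLike.congr_fun h (1, t)
  simp only [blockChar, MonoidHom.pow_apply, MonoidHom.comp_apply, MonoidHom.coe_mk, OneHom.coe_mk,
    Units.val_one, map_one, one_mul, MulEquiv.toMonoidHom_eq_coe, MonoidHom.coe_coe,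
    MulEquiv.coe_prodComm, Prod.swap_prod_mk, inv_one, mul_one] at h1
  rw [← map_pow, ← map_pow] at h1
  have h2 := σ₂.injective h1
  have h3 : (t⁻¹) ^ 2 ^ i = t ^ 2 ^ j := Units.ext (by simpa using h2)
  rw [pow_add, ← h3, ← mul_pow, mul_inv_cancel, one_pow]

open Matrix

theorem mul_autMatrix_inv_mul {K L : Type} [Field K] [Fintype K] {m n : Type} [Fintype n]
    [DecidableEq n] [Field L] [Algebra K L] (hK : Fintype.card K = 2) (B : Basis n K L) (t : Lˣ)
    (X : Matrix m n K) :
    X * (autMatrix hK B (DistribMulAction.toModuleAut K L t⁻¹)).1 *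
      (autMatrix hK B (DistribMulAction.toModuleAut K L t)).1 = X := by
  rw [Matrix.mul_assoc, ← Matrix.SpecialLinearGroup.coe_mul, ← map_mul, ← map_mul,
    inv_mul_cancel, map_one, map_one, Matrix.SpecialLinearGroup.coe_one, Matrix.mul_one]

theorem mul_finrank_le_of_block {K : Type} [Field K] [Fintype K] {m n : Type} [Fintype m]
    [DecidableEq m] [Fintype n] [DecidableEq n] [Nonempty m] [Nonempty n] [Algebra K L₁]
    [Algebra K L₂] (hK : Fintype.card K = 2)
    (B₁ : Basis m K L₁) (B₂ : Basis n K L₂) {G M : Type} [IsAlgClosed F] [CharP F 2] [CharP K 2]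
    [Group G] [Finite G] [AddCommGroup M] [Module F M] [FiniteDimensional F M] {a b : ℕ}
    (h₁ : Fintype.card L₁ = 2 ^ a) (h₂ : Fintype.card L₂ = 2 ^ b) (hab : a.Coprime b)
    (ha : 1 ≤ a) (hb : 3 ≤ b) (Φ : Matrix.SpecialLinearGroup (m ⊕ n) K ≃* G)
    (ρ : Representation F G M) (hinv : ∀ v, (∀ g, ρ g v = v) → v = 0) :
    a * b * finrank F (groupCohomology (Rep.of ρ) 1) ≤ finrank F M := by
  classical
  have : FiniteDimensional K L₁ := .of_basis B₁
  have : FiniteDimensional K L₂ := .of_basis B₂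
  have : Fact (Nat.Prime 2) := ⟨Nat.prime_two⟩
  let _ : Algebra (ZMod 2) F := ZMod.algebra F 2
  let _ : Algebra (ZMod 2) L₁ := ZMod.algebra L₁ 2
  let _ : Algebra (ZMod 2) L₂ := ZMod.algebra L₂ 2
  let σ₁ : L₁ →+* F := (IsAlgClosed.lift (R := ZMod 2) (S := L₁) (M := F)).toRingHom
  let σ₂ : L₂ →+* F := (IsAlgClosed.lift (R := ZMod 2) (S := L₂) (M := F)).toRingHom
  let θ : L₁ˣ × L₂ˣ →* G := Φ.toMonoidHom.comp (blockTorus hK B₁ B₂)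
  let sw : L₁ˣ × L₂ˣ ≃* L₂ˣ × L₁ˣ := MulEquiv.prodComm
  have hcard : Odd (Fintype.card (L₁ˣ × L₂ˣ)) := by
    rw [Fintype.card_prod, Fintype.card_units, Fintype.card_units, h₁, h₂]
    have e1 : 2 ∣ 2 ^ a := dvd_pow_self 2 (by omega)
    have e2 : 2 ∣ 2 ^ b := dvd_pow_self 2 (by omega)
    have p1 : 0 < 2 ^ a := by positivity
    have p2 : 0 < 2 ^ b := by positivity
    exact (Nat.odd_iff.2 (by omega)).mul (Nat.odd_iff.2 (by omega))
  have hcardF : (Fintype.card (L₁ˣ × L₂ˣ) : F) ≠ 0 := by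
    rw [Ne, CharP.cast_eq_zero_iff F 2, ← even_iff_two_dvd, Nat.not_even_iff_odd]
    exact hcard
  refine mul_finrank_groupCohomology_le_of_frobenius ρ hinv hcardF
    (θ := θ) (w := Φ (blockFrob hK B₁ B₂)) (by
      rw [Nat.card_eq_fintype_card]; exact Nat.coprime_two_right.2 hcard) (fun x => ?_)
    (fun i => bif i then blockChar σ₁ σ₂ else (blockChar σ₂ σ₁).comp sw.toMonoidHom) (a * b) ?_
    (fun i => bif i then Φ (upperBlock (rankOne B₁ B₂ 1 1)) else
      Φ (lowerBlock (rankOne B₂ B₁ 1 1))) ?_ ?_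
  · change Φ _ * Φ _ = Φ _ * Φ _
    rw [← map_mul, blockFrob_mul_blockTorus, map_mul]
  · have hfin : ∀ {i j : Fin (a * b)}, (i : ℕ) ≡ j [MOD a * b] → i = j := fun h =>
      Fin.ext (Nat.ModEq.eq_of_lt_of_lt h (Fin.is_lt _) (Fin.is_lt _))
    rintro ⟨i, _ | _⟩ ⟨j, _ | _⟩ h
    · refine Prod.ext (hfin ?_) rfl
      have h' : blockChar σ₂ σ₁ ^ 2 ^ (i : ℕ) = blockChar σ₂ σ₁ ^ 2 ^ (j : ℕ) :=
        MonoidHom.ext fun x => DFunLike.congr_fun h (sw.symm x)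
      have h3 := modEq_of_blockChar_pow_eq h₂ h₁ hab.symm h'
      rw [mul_comm b a] at h3
      exact h3
    · exact (blockChar_pow_ne_swap h₂ hb h.symm).elim
    · exact (blockChar_pow_ne_swap h₂ hb h).elim
    · exact Prod.ext (hfin (modEq_of_blockChar_pow_eq h₁ h₂ hab h)) rfl
  · rintro (_ | _)
    · change Φ _ * Φ _ = Φ _ * Φ _
      rw [← map_mul, ← map_mul]
      congr 1
      refine blockHom_mul_lowerBlock ?_
      rw [autMatrix_mul_rankOne, rankOne_one_mul_frob]
      exact congrArg (fun y => rankOne B₂ B₁ y 1)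
        (map_one (FiniteField.frobeniusAlgEquivOfAlgebraic K L₂))
    · change Φ _ * Φ _ = Φ _ * Φ _
      rw [← map_mul, ← map_mul]
      congr 1
      refine blockHom_mul_upperBlock ?_
      rw [autMatrix_mul_rankOne, rankOne_one_mul_frob]
      exact congrArg (fun y => rankOne B₁ B₂ y 1)
        (map_one (FiniteField.frobeniusAlgEquivOfAlgebraic K L₁))
  · intro c hc hcA h0
    refine cocycleSpace_eq_zero_of_closure hc (S := Φ '' (Set.range upperBlock ∪ Set.range lowerBlock))
      ?_ ?_
    · change Subgroup.closure (Φ.toMonoidHom '' _) = ⊤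
      rw [← MonoidHom.map_closure, closure_blocks_eq_top, ← MonoidHom.range_eq_map,
        MonoidHom.range_eq_top]
      exact Φ.surjective
    · rintro _ ⟨_, ⟨X, rfl⟩ | ⟨X, rfl⟩, rfl⟩
      · refine cocycleSpace_eq_zero_of_block hK B₁ B₂ h₁ h₂ hab hcardF (θ := θ)
          (fun X => Φ (upperBlock X)) (fun X Y => by rw [upperBlock_add, map_mul]) (fun s t X => ?_)
          σ₁ σ₂ hc hcA (fun j => h0 true j) X
        change Φ _ * Φ _ = Φ _ * Φ _
        rw [← map_mul, ← map_mul]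
        congr 1
        refine blockHom_mul_upperBlock ?_
        exact (mul_autMatrix_inv_mul hK B₂ t _).symm
      · refine cocycleSpace_eq_zero_of_block hK B₂ B₁ h₂ h₁ hab.symm ?_
          (θ := θ.comp sw.symm.toMonoidHom)
          (fun X => Φ (lowerBlock X)) (fun X Y => by rw [lowerBlock_add, map_mul]) (fun s t X => ?_)
          σ₂ σ₁ hc (fun a => hcA _) (fun j => ?_) X
        · rwa [Fintype.card_congr sw.toEquiv] at hcardF
        · change Φ _ * Φ _ = Φ _ * Φ _
          rw [← map_mul, ← map_mul]
          congr 1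
          refine blockHom_mul_lowerBlock ?_
          exact (mul_autMatrix_inv_mul hK B₁ t _).symm
        · have h3 := weightProj_comp_equiv ρ θ (((blockChar σ₂ σ₁).comp sw.toMonoidHom) ^ 2 ^ j) sw.symm
            (c (Φ (lowerBlock (rankOne B₂ B₁ 1 1))))
          have h4 : (((blockChar σ₂ σ₁).comp sw.toMonoidHom) ^ 2 ^ j).comp sw.symm.toMonoidHom =
            blockChar σ₂ σ₁ ^ 2 ^ j := MonoidHom.ext fun x => rfl
          rw [h4] at h3
          exact h3.trans (h0 false j)

end BlockBound

section TwoElements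

open Matrix

/-- Reindexing of special linear groups. -/
def specialLinearReindex (R : Type) [CommRing R] {m n : Type} [Fintype m] [DecidableEq m]
    [Fintype n] [DecidableEq n] (e : m ≃ n) :
    Matrix.SpecialLinearGroup m R ≃* Matrix.SpecialLinearGroup n R where
  toFun g := ⟨reindex e e g.1, by rw [det_reindex_self, g.2]⟩
  invFun g := ⟨(reindex e e).symm g.1, by rw [reindex_symm, det_reindex_self, g.2]⟩
  left_inv g := Subtype.ext ((reindex e e).symm_apply_apply g.1)
  right_inv g := Subtype.ext ((reindex e e).apply_symm_apply g.1)
  map_mul' g h := Subtype.ext (map_mul (reindexRingEquiv R e) g.1 h.1)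

theorem mul_finrank_le_of_card_eq_two {K : Type} [Field K] [Fintype K] (hK : Fintype.card K = 2)
    {F M : Type} [Field F] [IsAlgClosed F] [CharP F 2] [CharP K 2] [AddCommGroup M] [Module F M]
    [FiniteDimensional F M] {d : ℕ} (hd : 4 ≤ d)
    (ρ : Representation F (Matrix.SpecialLinearGroup (Fin d) K) M)
    (hinv : ∀ v, (∀ g, ρ g v = v) → v = 0) {l : ℕ} (hl : l.Prime) (hld : l ≤ d) :
    l * finrank F (groupCohomology (Rep.of ρ) 1) ≤ finrank F M := by
  have : Fact (Nat.Prime 2) := ⟨Nat.prime_two⟩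
  obtain ⟨a, b, ha, hb, hab, hadd, hle⟩ : ∃ a b : ℕ, 1 ≤ a ∧ 3 ≤ b ∧ a.Coprime b ∧ a + b = d ∧
      l ≤ a * b := by
    rcases Nat.even_or_odd d with h | h
    · refine ⟨1, d - 1, le_rfl, by omega, Nat.coprime_one_left _, by omega, ?_⟩
      have : l ≠ d := by
        rintro rfl
        have := hl.eq_two_or_odd'
        rcases this with h2 | h2
        · omega
        · exact Nat.not_even_iff_odd.2 h2 h
      omega
    · have := Nat.odd_iff.1 h
      refine ⟨2, d - 2, by omega, by omega, ?_, by omega, by omega⟩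
      rw [Nat.coprime_two_left, Nat.odd_iff]
      omega
  subst hadd
  have : NeZero a := ⟨by omega⟩
  have : NeZero b := ⟨by omega⟩
  let L₁ := FiniteField.Extension K 2 a
  let L₂ := FiniteField.Extension K 2 b
  let _ : Fintype L₁ := Fintype.ofFinite L₁
  let _ : Fintype L₂ := Fintype.ofFinite L₂
  have : CharP L₁ 2 := charP_of_injective_algebraMap (algebraMap K L₁).injective 2
  have : CharP L₂ 2 := charP_of_injective_algebraMap (algebraMap K L₂).injective 2
  have h₁ : Fintype.card L₁ = 2 ^ a := by
    rw [Fintype.card_eq_nat_card, FiniteField.natCard_extension, Nat.card_eq_fintype_card, hK]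
  have h₂ : Fintype.card L₂ = 2 ^ b := by
    rw [Fintype.card_eq_nat_card, FiniteField.natCard_extension, Nat.card_eq_fintype_card, hK]
  refine (Nat.mul_le_mul_right _ hle).trans ?_
  exact mul_finrank_le_of_block hK
    (finBasisOfFinrankEq K L₁ (FiniteField.finrank_extension K 2 a))
    (finBasisOfFinrankEq K L₂ (FiniteField.finrank_extension K 2 b)) h₁ h₂ hab ha hb
    (specialLinearReindex K finSumFinEquiv) ρ hinv

end TwoElements

section SmallFields

theorem finrank_groupCohomology_le_of_zpowers {F G₀ G M : Type} [Field F] [Group G₀] [Group G]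
    [Finite G] [AddCommGroup M] [Module F M] [FiniteDimensional F M] (ρ : Representation F G M)
    (hinv : ∀ v, (∀ g, ρ g v = v) → v = 0) (Φ : G₀ →* G) (hΦ : Function.Surjective Φ)
    {s w t : G₀} {n m r k : ℕ} (hn : (n : F) ≠ 0) (hs : s ^ n = 1) (hws : w * s ^ m = s * w)
    (hr : (r : F) ≠ 0) (ht : t ^ r = 1) (hk : w * t = t ^ k * w) (hkr : k.Coprime r)
    (hgen : Subgroup.closure {s, w, t} = ⊤) :
    finrank F (groupCohomology (Rep.of ρ) 1) ≤
      finrank F (normalizedFixed ρ (Φ w) (Φ t) r) := by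
  let _ : Fintype (Subgroup.zpowers (Φ s)) := Fintype.ofFinite _
  refine finrank_groupCohomology_le_normalizedFixed ρ hinv ?_ (Subgroup.zpowers (Φ s)).subtype
    (Φ w) (Φ t) ?_ hr (by rw [← map_pow, ht, map_one])
    (by rw [← map_mul, hk, map_mul, map_pow]) hkr ?_
  · rw [← Nat.card_eq_fintype_card, Nat.card_zpowers]
    obtain ⟨c, hc⟩ := orderOf_dvd_of_pow_eq_one (x := Φ s) (n := n) (by rw [← map_pow, hs, map_one])
    intro h0
    rw [hc, Nat.cast_mul, h0, zero_mul] at hn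
    exact hn rfl
  · rintro ⟨_, j, rfl⟩
    refine ⟨⟨(Φ s ^ m) ^ j, Subgroup.zpow_mem _ (Subgroup.pow_mem _
      (Subgroup.mem_zpowers _) _) _⟩, ?_⟩
    have h1 : SemiconjBy (Φ w) (Φ s ^ m) (Φ s) := by
      have h2 := congrArg Φ hws
      rwa [map_mul, map_mul, map_pow] at h2
    exact h1.zpow_right j
  · have h1 := congrArg (Subgroup.map Φ) hgen
    rw [MonoidHom.map_closure, ← MonoidHom.range_eq_map, MonoidHom.range_eq_top.2 hΦ] at h1
    rw [eq_top_iff, ← h1, Subgroup.closure_le]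
    rintro _ ⟨x, hx, rfl⟩
    rcases hx with rfl | rfl | rfl
    · exact Subgroup.subset_closure (Or.inl ⟨⟨Φ x, Subgroup.mem_zpowers _⟩, rfl⟩)
    · exact Subgroup.subset_closure (Or.inr (Or.inl rfl))
    · exact Subgroup.subset_closure (Or.inr (Or.inr rfl))

open Matrix

variable {ι R : Type} [Fintype ι] [DecidableEq ι] [Field R]

theorem specialLinearGroup_map_surjective {K : Type} [Field K] (e : R ≃+* K) :
    Function.Surjective (Matrix.SpecialLinearGroup.map (n := ι) e.toRingHom) := by
  intro g
  refine ⟨Matrix.SpecialLinearGroup.map e.symm.toRingHom g, specialLinearGroup_ext ?_⟩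
  ext i j
  exact e.apply_symm_apply _

theorem rootJoined_of_add_generators {H : Subgroup (Matrix.SpecialLinearGroup ι R)} {i j : ι}
    (a b : R) (hab : ∀ x : R, ∃ m n : ℕ, x = m • a + n • b)
    (ha : ∀ h : i ≠ j, SpecialLinearGroup.transvection h a ∈ H)
    (hb : ∀ h : i ≠ j, SpecialLinearGroup.transvection h b ∈ H) : RootJoined H i j := by
  intro h x
  have key : ∀ (n : ℕ) (y : R), SpecialLinearGroup.transvection h y ∈ H →
      SpecialLinearGroup.transvection h (n • y) ∈ H := by
    intro n y hy
    induction n with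
    | zero =>
      rw [zero_smul, SpecialLinearGroup.transvection_coeff_zero]
      exact H.one_mem
    | succ n ih =>
      rw [succ_nsmul, SpecialLinearGroup.transvection_add]
      exact H.mul_mem ih hy
  obtain ⟨m, n, rfl⟩ := hab x
  rw [SpecialLinearGroup.transvection_add]
  exact H.mul_mem (key m a (ha h)) (key n b (hb h))

theorem eq_top_of_transvections_fin_two {H : Subgroup (Matrix.SpecialLinearGroup (Fin 2) R)}
    (a b : R) (hab : ∀ x : R, ∃ m n : ℕ, x = m • a + n • b)
    (h01 : (0 : Fin 2) ≠ 1) (h10 : (1 : Fin 2) ≠ 0)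
    (ha : SpecialLinearGroup.transvection h01 a ∈ H)
    (ha' : SpecialLinearGroup.transvection h10 a ∈ H)
    (hb : SpecialLinearGroup.transvection h01 b ∈ H)
    (hb' : SpecialLinearGroup.transvection h10 b ∈ H) : H = ⊤ := by
  refine eq_top_of_transvections fun i j => ?_
  fin_cases i <;> fin_cases j
  · exact fun h => absurd rfl h
  · exact rootJoined_of_add_generators a b hab (fun _ => ha) (fun _ => hb)
  · exact rootJoined_of_add_generators a b hab (fun _ => ha') (fun _ => hb')
  · exact fun h => absurd rfl h

theorem eq_top_of_transvections_fin_three {H : Subgroup (Matrix.SpecialLinearGroup (Fin 3) R)}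
    (a b : R) (hab : ∀ x : R, ∃ m n : ℕ, x = m • a + n • b)
    {w : Matrix.SpecialLinearGroup (Fin 3) R} (hw : w ∈ H)
    (hwc : w.1 = !![0, 1, 0; 0, 0, 1; 1, 0, 0])
    (h01 : (0 : Fin 3) ≠ 1)
    (ha : SpecialLinearGroup.transvection h01 a ∈ H)
    (hb : SpecialLinearGroup.transvection h01 b ∈ H) : H = ⊤ := by
  have step : ∀ i : Fin 3, RootJoined H i (i + 1) → RootJoined H (i + 2) i := by
    intro i hi h x
    have hii : i ≠ i + 1 := (by decide : ∀ i : Fin 3, i ≠ i + 1) i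
    have h1 : w * SpecialLinearGroup.transvection hii x =
        SpecialLinearGroup.transvection h x * w := by
      refine specialLinearGroup_ext ?_
      change w.1 * Matrix.transvection _ _ _ = Matrix.transvection _ _ _ * w.1
      rw [hwc]
      fin_cases i <;> ext k l <;> fin_cases k <;> fin_cases l <;>
        simp [Matrix.transvection, Matrix.mul_apply, Fin.sum_univ_three, Matrix.one_apply,
          Matrix.single_apply]
    rw [← mul_inv_eq_iff_eq_mul] at h1
    rw [← h1]
    exact H.mul_mem (H.mul_mem hw (hi hii x)) (H.inv_mem hw)
  have r01 : RootJoined H 0 1 := rootJoined_of_add_generators a b hab (fun _ => ha) (fun _ => hb)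
  have r20 : RootJoined H 2 0 := step 0 r01
  have r12 : RootJoined H 1 2 := step 2 r20
  refine eq_top_of_transvections fun i j => ?_
  fin_cases i <;> fin_cases j
  · exact fun h => absurd rfl h
  · exact r01
  · exact r01.trans r12
  · exact r12.trans r20
  · exact fun h => absurd rfl h
  · exact r12
  · exact r20
  · exact r20.trans r01
  · exact fun h => absurd rfl h

end SmallFields

section SmallRankTwo

open Matrix

theorem two_mul_finrank_le_of_generators {R K F M : Type} [Field R] [Field K] [Finite K] [Field F]
    [AddCommGroup M] [Module F M] [FiniteDimensional F M] (e : R ≃+* K)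
    (ρ : Representation F (Matrix.SpecialLinearGroup (Fin 2) K) M)
    (hinv : ∀ v, (∀ g, ρ g v = v) → v = 0)
    {s w t : Matrix.SpecialLinearGroup (Fin 2) R}
    {n m r : ℕ} (hn : (n : F) ≠ 0) (hs : s ^ n = 1) (hws : w * s ^ m = s * w)
    (hr : ((r + 1 : ℕ) : F) ≠ 0) (hodd : Odd (r + 1)) (ht : t ^ (r + 1) = 1)
    (hk : w * t = t ^ r * w)
    (hgen : Subgroup.closure {s, w, t} = ⊤) :
    2 * finrank F (groupCohomology (Rep.of ρ) 1) ≤ finrank F M := by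
  have : Finite (Matrix (Fin 2) (Fin 2) K) := inferInstanceAs (Finite (Fin 2 → Fin 2 → K))
  have : Finite (Matrix.SpecialLinearGroup (Fin 2) K) := Finite.of_injective _ Subtype.val_injective
  refine (Nat.mul_le_mul_left 2 (finrank_groupCohomology_le_of_zpowers ρ hinv
    (Matrix.SpecialLinearGroup.map (n := Fin 2) e.toRingHom) (specialLinearGroup_map_surjective e)
    hn hs hws hr ht hk (by simp) hgen)).trans ?_
  refine two_mul_finrank_normalizedFixed hr hodd (by rw [← map_pow, ht, map_one]) ?_
  have h1 : t⁻¹ = t ^ r := inv_eq_of_mul_eq_one_left (by rw [← pow_succ, ht])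
  rw [← map_mul, hk, map_mul, ← h1, map_inv]

theorem natCast_ne_zero_of_not_dvd {F : Type} [Field F] (p : ℕ) [CharP F p] {n : ℕ}
    (h : ¬ p ∣ n) : (n : F) ≠ 0 := fun h0 => h ((CharP.cast_eq_zero_iff F p n).1 h0)

instance fact_prime_five : Fact (Nat.Prime 5) := ⟨by norm_num⟩

theorem two_mul_finrank_le_of_card_eq_five {K F M : Type} [Field K] [Fintype K]
    (hK : Fintype.card K = 5) [Field F] [CharP F 5]
    [AddCommGroup M] [Module F M] [FiniteDimensional F M]
    (ρ : Representation F (Matrix.SpecialLinearGroup (Fin 2) K) M)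
    (hinv : ∀ v, (∀ g, ρ g v = v) → v = 0) :
    2 * finrank F (groupCohomology (Rep.of ρ) 1) ≤ finrank F M := by
  let e : ZMod 5 ≃+* K := FiniteField.ringEquivOfCardEq (by rw [hK, ZMod.card])
  let s : Matrix.SpecialLinearGroup (Fin 2) (ZMod 5) := ⟨!![0, 1; 4, 0], by decide⟩
  let w : Matrix.SpecialLinearGroup (Fin 2) (ZMod 5) := ⟨!![0, 2; 2, 0], by decide⟩
  let t : Matrix.SpecialLinearGroup (Fin 2) (ZMod 5) := ⟨!![0, 4; 1, 4], by decide⟩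
  refine two_mul_finrank_le_of_generators e ρ hinv (s := s) (w := w) (t := t) (n := 4) (m := 3)
    (r := 2) (natCast_ne_zero_of_not_dvd 5 (by norm_num)) (by decide +kernel) (by decide +kernel)
    (natCast_ne_zero_of_not_dvd 5 (by norm_num)) (by decide) (by decide +kernel)
    (by decide +kernel) ?_
  have hs : s ∈ Subgroup.closure {s, w, t} := Subgroup.subset_closure (by simp)
  have hw : w ∈ Subgroup.closure {s, w, t} := Subgroup.subset_closure (by simp)
  have ht : t ∈ Subgroup.closure {s, w, t} := Subgroup.subset_closure (by simp)
  have h1 : SpecialLinearGroup.transvection zero_ne_one (1 : ZMod 5) ∈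
      Subgroup.closure {s, w, t} := by
    rw [show SpecialLinearGroup.transvection _ (1 : ZMod 5) = w * t * w * s by decide +kernel]
    exact mul_mem (mul_mem (mul_mem hw ht) hw) hs
  have h2 : SpecialLinearGroup.transvection one_ne_zero (1 : ZMod 5) ∈
      Subgroup.closure {s, w, t} := by
    rw [show SpecialLinearGroup.transvection _ (1 : ZMod 5) = t * s by decide +kernel]
    exact mul_mem ht hs
  exact eq_top_of_transvections_fin_two 1 1 (fun x => ⟨x.val, 0, by simp⟩) _ _ h1 h2 h1 h2

instance fact_quadratic_two : Fact (∀ r : ZMod 2, r ^ 2 ≠ 1 + 1 * r) := ⟨by decide⟩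

instance fact_quadratic_three : Fact (∀ r : ZMod 3, r ^ 2 ≠ -1 + 0 * r) := ⟨by decide⟩

instance fintypeQuadraticAlgebra {R : Type} [Fintype R] (a b : R) :
    Fintype (QuadraticAlgebra R a b) := Fintype.ofEquiv _ (QuadraticAlgebra.equivProd a b).symm

theorem card_quadraticAlgebra {R : Type} [Fintype R] (a b : R) :
    Fintype.card (QuadraticAlgebra R a b) = Fintype.card R * Fintype.card R := by
  rw [Fintype.ofEquiv_card, Fintype.card_prod]

theorem quadraticAlgebra_eq_nsmul {p : ℕ} [NeZero p] (a b : ZMod p)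
    (x : QuadraticAlgebra (ZMod p) a b) :
    ∃ m n : ℕ, x = m • (1 : QuadraticAlgebra (ZMod p) a b) + n • ⟨0, 1⟩ :=
  ⟨x.re.val, x.im.val, by
    ext
    · change x.re = x.re.val • 1 + x.im.val • 0
      simp
    · change x.im = x.re.val • 0 + x.im.val • 1
      simp⟩

local notation "F₄" => QuadraticAlgebra (ZMod 2) 1 1

theorem two_mul_finrank_le_of_card_eq_four {K F M : Type} [Field K] [Fintype K]
    (hK : Fintype.card K = 4) [Field F] [CharP F 2]
    [AddCommGroup M] [Module F M] [FiniteDimensional F M]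
    (ρ : Representation F (Matrix.SpecialLinearGroup (Fin 2) K) M)
    (hinv : ∀ v, (∀ g, ρ g v = v) → v = 0) :
    2 * finrank F (groupCohomology (Rep.of ρ) 1) ≤ finrank F M := by
  let e : F₄ ≃+* K :=
    FiniteField.ringEquivOfCardEq (by rw [hK, card_quadraticAlgebra, ZMod.card])
  let s : Matrix.SpecialLinearGroup (Fin 2) F₄ := ⟨!![0, ⟨0, 1⟩; ⟨1, 1⟩, ⟨0, 1⟩], by decide +kernel⟩
  let w : Matrix.SpecialLinearGroup (Fin 2) F₄ := ⟨!![0, ⟨0, 1⟩; ⟨1, 1⟩, 0], by decide +kernel⟩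
  let t : Matrix.SpecialLinearGroup (Fin 2) F₄ := ⟨!![1, ⟨0, 1⟩; ⟨1, 1⟩, 0], by decide +kernel⟩
  refine two_mul_finrank_le_of_generators e ρ hinv (s := s) (w := w) (t := t) (n := 5) (m := 4)
    (r := 2) (natCast_ne_zero_of_not_dvd 2 (by norm_num)) (by decide +kernel) (by decide +kernel)
    (natCast_ne_zero_of_not_dvd 2 (by norm_num)) (by decide) (by decide +kernel)
    (by decide +kernel) ?_
  have hs : s ∈ Subgroup.closure {s, w, t} := Subgroup.subset_closure (by simp)
  have hw : w ∈ Subgroup.closure {s, w, t} := Subgroup.subset_closure (by simp)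
  have ht : t ∈ Subgroup.closure {s, w, t} := Subgroup.subset_closure (by simp)
  refine eq_top_of_transvections_fin_two 1 ⟨0, 1⟩ (quadraticAlgebra_eq_nsmul 1 1)
    zero_ne_one one_ne_zero ?_ ?_ ?_ ?_
  · rw [show SpecialLinearGroup.transvection _ (1 : F₄) = t * s by decide +kernel]
    exact mul_mem ht hs
  · rw [show SpecialLinearGroup.transvection _ (1 : F₄) = s * w by decide +kernel]
    exact mul_mem hs hw
  · rw [show SpecialLinearGroup.transvection _ (⟨0, 1⟩ : F₄) = t * w by decide +kernel]
    exact mul_mem ht hw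
  · rw [show SpecialLinearGroup.transvection _ (⟨0, 1⟩ : F₄) = s * t by decide +kernel]
    exact mul_mem hs ht

local notation "F₉" => QuadraticAlgebra (ZMod 3) (-1) 0

theorem two_mul_finrank_le_of_card_eq_nine {K F M : Type} [Field K] [Fintype K]
    (hK : Fintype.card K = 9) [Field F] [CharP F 3]
    [AddCommGroup M] [Module F M] [FiniteDimensional F M]
    (ρ : Representation F (Matrix.SpecialLinearGroup (Fin 2) K) M)
    (hinv : ∀ v, (∀ g, ρ g v = v) → v = 0) :
    2 * finrank F (groupCohomology (Rep.of ρ) 1) ≤ finrank F M := by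
  let e : F₉ ≃+* K :=
    FiniteField.ringEquivOfCardEq (by rw [hK, card_quadraticAlgebra, ZMod.card])
  let s : Matrix.SpecialLinearGroup (Fin 2) F₉ :=
    ⟨!![0, ⟨0, 1⟩; ⟨0, 1⟩, ⟨1, 1⟩], by decide +kernel⟩
  let w : Matrix.SpecialLinearGroup (Fin 2) F₉ := ⟨!![0, 1; -1, 0], by decide +kernel⟩
  let t : Matrix.SpecialLinearGroup (Fin 2) F₉ :=
    ⟨!![0, ⟨0, 2⟩; ⟨0, 2⟩, ⟨1, 2⟩], by decide +kernel⟩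
  refine two_mul_finrank_le_of_generators e ρ hinv (s := s) (w := w) (t := t) (n := 5) (m := 4)
    (r := 4) (natCast_ne_zero_of_not_dvd 3 (by norm_num)) (by decide +kernel) (by decide +kernel)
    (natCast_ne_zero_of_not_dvd 3 (by norm_num)) (by decide) (by decide +kernel)
    (by decide +kernel) ?_
  have hs : s ∈ Subgroup.closure {s, w, t} := Subgroup.subset_closure (by simp)
  have hw : w ∈ Subgroup.closure {s, w, t} := Subgroup.subset_closure (by simp)
  have ht : t ∈ Subgroup.closure {s, w, t} := Subgroup.subset_closure (by simp)
  refine eq_top_of_transvections_fin_two 1 ⟨0, 1⟩ (quadraticAlgebra_eq_nsmul (-1) 0)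
    zero_ne_one one_ne_zero ?_ ?_ ?_ ?_
  · rw [show SpecialLinearGroup.transvection _ (1 : F₉) = s * t ^ 3 * s * t by decide +kernel]
    exact mul_mem (mul_mem (mul_mem hs (pow_mem ht 3)) hs) ht
  · rw [show SpecialLinearGroup.transvection _ (1 : F₉) = s * t * s ^ 3 * t by decide +kernel]
    exact mul_mem (mul_mem (mul_mem hs ht) (pow_mem hs 3)) ht
  · rw [show SpecialLinearGroup.transvection _ (⟨0, 1⟩ : F₉) = w * t * w * s by decide +kernel]
    exact mul_mem (mul_mem (mul_mem hw ht) hw) hs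
  · rw [show SpecialLinearGroup.transvection _ (⟨0, 1⟩ : F₉) = s * w * t * w by decide +kernel]
    exact mul_mem (mul_mem (mul_mem hs hw) ht) hw

end SmallRankTwo

section SmallRankThree

open Matrix

theorem three_mul_finrank_le_of_generators {R K F M : Type} [Field R] [Field K] [Finite K]
    [Field F] [AddCommGroup M] [Module F M] [FiniteDimensional F M] (e : R ≃+* K)
    (ρ : Representation F (Matrix.SpecialLinearGroup (Fin 3) K) M)
    (hinv : ∀ v, (∀ g, ρ g v = v) → v = 0)
    {s w t : Matrix.SpecialLinearGroup (Fin 3) R}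
    {m : ℕ} (hr : ((7 : ℕ) : F) ≠ 0) (hs : s ^ 7 = 1) (hws : w * s ^ m = s * w)
    (ht : t ^ 7 = 1) (hk : w * t = t ^ 2 * w)
    (hgen : Subgroup.closure {s, w, t} = ⊤) :
    3 * finrank F (groupCohomology (Rep.of ρ) 1) ≤ finrank F M := by
  have : Finite (Matrix (Fin 3) (Fin 3) K) := inferInstanceAs (Finite (Fin 3 → Fin 3 → K))
  have : Finite (Matrix.SpecialLinearGroup (Fin 3) K) := Finite.of_injective _ Subtype.val_injective
  refine (Nat.mul_le_mul_left 3 (finrank_groupCohomology_le_of_zpowers ρ hinv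
    (Matrix.SpecialLinearGroup.map (n := Fin 3) e.toRingHom) (specialLinearGroup_map_surjective e)
    hr hs hws hr ht hk (by decide) hgen)).trans ?_
  exact three_mul_finrank_normalizedFixed hr (by rw [← map_pow, ht, map_one])
    (by rw [← map_mul, hk, map_mul, map_pow])

theorem three_mul_finrank_le_of_card_eq_two {K F M : Type} [Field K] [Fintype K]
    (hK : Fintype.card K = 2) [Field F] [CharP F 2]
    [AddCommGroup M] [Module F M] [FiniteDimensional F M]
    (ρ : Representation F (Matrix.SpecialLinearGroup (Fin 3) K) M)
    (hinv : ∀ v, (∀ g, ρ g v = v) → v = 0) :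
    3 * finrank F (groupCohomology (Rep.of ρ) 1) ≤ finrank F M := by
  let e : ZMod 2 ≃+* K := FiniteField.ringEquivOfCardEq (by rw [hK, ZMod.card])
  let s : Matrix.SpecialLinearGroup (Fin 3) (ZMod 2) :=
    ⟨!![0, 1, 0; 1, 0, 1; 0, 1, 1], by decide +kernel⟩
  let w : Matrix.SpecialLinearGroup (Fin 3) (ZMod 2) :=
    ⟨!![0, 1, 0; 0, 0, 1; 1, 0, 0], by decide +kernel⟩
  let t : Matrix.SpecialLinearGroup (Fin 3) (ZMod 2) :=
    ⟨!![0, 1, 1; 1, 0, 0; 1, 0, 1], by decide +kernel⟩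
  refine three_mul_finrank_le_of_generators e ρ hinv (s := s) (w := w) (t := t) (m := 2)
    (natCast_ne_zero_of_not_dvd 2 (by norm_num)) (by decide +kernel) (by decide +kernel)
    (by decide +kernel) (by decide +kernel) ?_
  have hs : s ∈ Subgroup.closure {s, w, t} := Subgroup.subset_closure (by simp)
  have hw : w ∈ Subgroup.closure {s, w, t} := Subgroup.subset_closure (by simp)
  have ht : t ∈ Subgroup.closure {s, w, t} := Subgroup.subset_closure (by simp)
  have h1 : SpecialLinearGroup.transvection zero_ne_one (1 : ZMod 2) ∈
      Subgroup.closure {s, w, t} := by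
    rw [show SpecialLinearGroup.transvection _ (1 : ZMod 2) = t * s by decide +kernel]
    exact mul_mem ht hs
  exact eq_top_of_transvections_fin_three 1 1 (fun x => ⟨x.val, 0, by simp⟩) hw rfl _ h1 h1

local notation "F₄" => QuadraticAlgebra (ZMod 2) 1 1

theorem three_mul_finrank_le_of_card_eq_four {K F M : Type} [Field K] [Fintype K]
    (hK : Fintype.card K = 4) [Field F] [CharP F 2]
    [AddCommGroup M] [Module F M] [FiniteDimensional F M]
    (ρ : Representation F (Matrix.SpecialLinearGroup (Fin 3) K) M)
    (hinv : ∀ v, (∀ g, ρ g v = v) → v = 0) :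
    3 * finrank F (groupCohomology (Rep.of ρ) 1) ≤ finrank F M := by
  let e : F₄ ≃+* K :=
    FiniteField.ringEquivOfCardEq (by rw [hK, card_quadraticAlgebra, ZMod.card])
  let s : Matrix.SpecialLinearGroup (Fin 3) F₄ :=
    ⟨!![0, 1, 0; 1, 1, 1; 0, 1, 1], by decide +kernel⟩
  let w : Matrix.SpecialLinearGroup (Fin 3) F₄ :=
    ⟨!![0, 1, 0; 0, 0, 1; 1, 0, 0], by decide +kernel⟩
  let t : Matrix.SpecialLinearGroup (Fin 3) F₄ :=
    ⟨!![0, ⟨0, 1⟩, 0; ⟨1, 1⟩, 1, ⟨0, 1⟩; 0, ⟨1, 1⟩, 1], by decide +kernel⟩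
  refine three_mul_finrank_le_of_generators e ρ hinv (s := s) (w := w) (t := t) (m := 4)
    (natCast_ne_zero_of_not_dvd 2 (by norm_num)) (by decide +kernel) (by decide +kernel)
    (by decide +kernel) (by decide +kernel) ?_
  have hs : s ∈ Subgroup.closure {s, w, t} := Subgroup.subset_closure (by simp)
  have hw : w ∈ Subgroup.closure {s, w, t} := Subgroup.subset_closure (by simp)
  have ht : t ∈ Subgroup.closure {s, w, t} := Subgroup.subset_closure (by simp)
  have hst := mul_mem hs ht
  have hts := mul_mem ht hs
  refine eq_top_of_transvections_fin_three 1 ⟨0, 1⟩ (quadraticAlgebra_eq_nsmul 1 1) hw rfl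
    zero_ne_one ?_ ?_
  · rw [show SpecialLinearGroup.transvection _ (1 : F₄) =
      t * s * (s * t) * (s * t) * (s * s) * (t * s) by decide +kernel]
    exact mul_mem (mul_mem (mul_mem (mul_mem hts hst) hst) (mul_mem hs hs)) hts
  · rw [show SpecialLinearGroup.transvection _ (⟨0, 1⟩ : F₄) =
      s * t * (t * s) * (t * s) * (t * t) * (s * t) by decide +kernel]
    exact mul_mem (mul_mem (mul_mem (mul_mem hst hts) hts) (mul_mem ht ht)) hst

end SmallRankThree

section Assembly

theorem base_eq_of_prime_pow_eq {p e r k : ℕ} (hp : p.Prime) (hr : r.Prime) (hk : k ≠ 0)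
    (h : p ^ e = r ^ k) : p = r := by
  have h1 : r ∣ p ^ e := h ▸ dvd_pow_self r hk
  exact ((Nat.prime_dvd_prime_iff_eq hr hp).1 (hr.dvd_of_dvd_pow h1)).symm

theorem exists_units_pow_ne_one {K : Type} [Field K] [Fintype K] {n : ℕ}
    (h : ¬ Fintype.card K - 1 ∣ n) : ∃ a : Kˣ, a ^ n ≠ 1 := by
  by_contra! h'
  exact h (card_sub_one_dvd_of_pow_eq_one h')

end Assembly

/-- Let `d ≥ 2`, `q = pᵉ` a prime power with `(d,q) ≠ (2,2), (2,3)`, and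
`G = SL(d,q)`.  Let `F` be an algebraically closed field of characteristic `p` and `M`
a finite-dimensional irreducible `FG`-module.  Then for every prime `ℓ ≤ d`,
`ℓ · dim H¹(G,M) ≤ dim M`. -/
theorem stmt_7 (p e q d : ℕ) (hp : p.Prime) (he : 0 < e) (hq : q = p ^ e) (hd : 2 ≤ d)
    (h22 : ¬(d = 2 ∧ q = 2)) (h23 : ¬(d = 2 ∧ q = 3))
    (K : Type) [Field K] [Fintype K] (hK : Fintype.card K = q)
    (F : Type) [Field F] [IsAlgClosed F] [CharP F p]
    (M : Type) [AddCommGroup M] [Module F M] [FiniteDimensional F M]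
    (ρ : Representation F (Matrix.SpecialLinearGroup (Fin d) K) M)
    (hnontrivial : Nontrivial M)
    (hirred : ∀ P : Submodule F M,
      (∀ (g : Matrix.SpecialLinearGroup (Fin d) K) (x : M), x ∈ P → ρ g x ∈ P) →
        P = ⊥ ∨ P = ⊤) :
    ∀ ℓ : ℕ, ℓ.Prime → ℓ ≤ d →
      ℓ * Module.finrank F (groupCohomology (Rep.of ρ) 1) ≤ Module.finrank F M := by
  subst hq
  intro l hl hld
  have : Fact p.Prime := ⟨hp⟩
  have : CharP K p := charP_of_card_eq_prime_pow hK
  have hq2 : 2 ≤ p ^ e := hK ▸ Fintype.one_lt_card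
  have : Nontrivial (Fin d) := Fin.nontrivial_iff_two_le.2 hd
  have hperf : ∀ f : Matrix.SpecialLinearGroup (Fin d) K →* Multiplicative M, ∀ g, f g = 1 := by
    intro f g
    refine hom_eq_one_of_commGroup f ?_ g
    rcases hd.lt_or_eq with h | h
    · refine Or.inl fun i j => ?_
      obtain ⟨k, hk⟩ := exists_fin_notMem {i, j} (Finset.card_le_two.trans_lt h)
      rw [Finset.mem_insert, Finset.mem_singleton, not_or] at hk
      exact ⟨k, hk⟩
    · refine Or.inr (exists_units_pow_ne_one fun h2 => ?_)
      have := Nat.le_of_dvd (by norm_num) h2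
      rw [hK] at this
      have h3 : p ^ e ≠ 2 := fun h3 => h22 ⟨h.symm, h3⟩
      have h4 : p ^ e ≠ 3 := fun h4 => h23 ⟨h.symm, h4⟩
      omega
  rcases invariants_or_finrank_eq_zero ρ hperf hirred with hinv | h0
  swap
  · rw [h0, mul_zero]
    exact Nat.zero_le _
  rcases Nat.lt_or_ge 3 d with h4 | h3
  · by_cases h2 : p ^ e = 2
    · obtain rfl := base_eq_of_prime_pow_eq (k := 1) hp Nat.prime_two one_ne_zero (h2.trans (pow_one 2).symm)
      exact mul_finrank_le_of_card_eq_two (hK.trans h2) h4 ρ hinv hl hld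
    · obtain ⟨a, ha⟩ := exists_units_pow_ne_one (K := K) (n := 1) fun h => by
        have := Nat.le_of_dvd one_pos h
        omega
      refine mul_finrank_le_of_four_le p h4 ρ hinv ⟨a, by rwa [pow_one] at ha⟩ hld ?_
      rcases Nat.lt_or_ge 4 d with h5 | h5
      · exact Or.inr h5
      · left
        refine lt_of_le_of_ne hld ?_
        rintro rfl
        obtain rfl : l = 4 := by omega
        exact absurd hl (by norm_num)
  rcases h3.lt_or_eq with h | rfl
  · obtain rfl : d = 2 := by omega
    obtain rfl : l = 2 := le_antisymm hld hl.two_le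
    by_cases hq : p ^ e = 2 ∨ p ^ e = 3 ∨ p ^ e = 4 ∨ p ^ e = 5 ∨ p ^ e = 9
    · rcases hq with hq | hq | hq | hq | hq
      · exact absurd ⟨rfl, hq⟩ h22
      · exact absurd ⟨rfl, hq⟩ h23
      · obtain rfl := base_eq_of_prime_pow_eq (k := 2) hp Nat.prime_two two_ne_zero hq
        exact two_mul_finrank_le_of_card_eq_four (hK.trans hq) ρ hinv
      · obtain rfl := base_eq_of_prime_pow_eq (k := 1) hp Nat.prime_five one_ne_zero (hq.trans (pow_one 5).symm)
        exact two_mul_finrank_le_of_card_eq_five (hK.trans hq) ρ hinv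
      · obtain rfl := base_eq_of_prime_pow_eq (k := 2) hp Nat.prime_three two_ne_zero hq
        exact two_mul_finrank_le_of_card_eq_nine (hK.trans hq) ρ hinv
    · exact two_mul_finrank_le p hK ρ hinv hq
  · refine (Nat.mul_le_mul_right _ hld).trans ?_
    by_cases h2 : p ^ e = 2
    · obtain rfl := base_eq_of_prime_pow_eq (k := 1) hp Nat.prime_two one_ne_zero (h2.trans (pow_one 2).symm)
      exact three_mul_finrank_le_of_card_eq_two (hK.trans h2) ρ hinv
    by_cases h4 : p ^ e = 4
    · obtain rfl := base_eq_of_prime_pow_eq (k := 2) hp Nat.prime_two two_ne_zero h4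
      exact three_mul_finrank_le_of_card_eq_four (hK.trans h4) ρ hinv
    refine three_mul_finrank_le p ρ hinv (exists_units_pow_ne_one fun h => ?_)
    rw [hK] at h
    rcases (Nat.dvd_prime Nat.prime_three).1 h with h | h <;> omega
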